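/- arXiv:2509.21001 — 2 statements merged into one kernel-verified Lean document; each statement's English description precedes it below -/
import Mathlib

section
/- Let E be a finite-dimensional real normed vector space, L : E → E an expansive linear automorphism, and P a pattern on E that is FLC, well-separated and L-sub with predecessor P'. Then P satisfies unique composition modulo K_P: for all U, V in the hull Ω_P with σ(U) = σ(V) = P, there exists g ∈ K_P with LU = LV + g, where σ : Ω_P → Ω_P is the substitution map. -/
open Metric Set Filter Topology Pointwise

variable {E : Type*} [NormedAddCommGroup E] [NormedSpace ℝ E] {S : Type*}

/-- Equality of the `U`-patches of the pattern `P` at `x` and of `Q` at `y`: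
`P[x,U] = Q[y,U]`. -/
def PatchEq (P Q : E → S) (x y : E) (U : Set E) : Prop :=
  ∀ u ∈ U, P (x + u) = Q (y + u)

/-- The translate `P + z` of a pattern `P`. -/
def transl (z : E) (P : E → S) : E → S := fun x => P (x - z)

/-- The distortion `L P` of a pattern `P` by a linear automorphism `L`. -/
def distort (L : E ≃ₗ[ℝ] E) (P : E → S) : E → S := fun x => P (L.symm x)

/-- `Q` is locally indistinguishable from `P` (`Q ≼ P`). -/
def LIfrom (Q P : E → S) : Prop :=
  ∀ U : Set E, IsCompact U → ∀ x : E, ∃ y : E, PatchEq Q P x y U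

/-- `P` and `Q` are locally isomorphic (`P ≈ Q`). -/
def LocIso (P Q : E → S) : Prop :=
  LIfrom P Q ∧ LIfrom Q P

/-- `Q` is locally derivable from `P` (`P ⊳ Q`). -/
def LD (P Q : E → S) : Prop :=
  ∃ c : ℝ, 0 ≤ c ∧ ∀ x y : E, PatchEq P P x y (closedBall 0 c) → Q x = Q y

/-- The group of translational periods of a pattern: `{g | P + g = P}`. -/
def periods (P : E → S) : AddSubgroup E where
  carrier := {g : E | ∀ x : E, P (x + g) = P x}
  zero_mem' := by intro x; rw [add_zero]
  add_mem' := by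
    intro a b ha hb
    simp only [Set.mem_setOf_eq] at ha hb ⊢
    intro x
    rw [← add_assoc, hb, ha]
  neg_mem' := by
    intro a ha
    simp only [Set.mem_setOf_eq] at ha ⊢
    intro x
    have h := ha (x + -a)
    have h2 : x + -a + a = x := by abel
    rw [h2] at h
    exact h.symm

/-- Finite local complexity (FLC) for a single pattern. -/
def IsFLC (P : E → S) : Prop :=
  ∀ U : Set E, IsCompact U → ∃ K : Set E, IsCompact K ∧ ∀ x : E, ∃ v ∈ K, PatchEq P P x v U

/-- Repetitivity for a single pattern. -/
def Repetitive (P : E → S) : Prop :=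
  ∀ U : Set E, IsCompact U →
    ∃ R : Set E, IsCompact R ∧ ∀ x y : E, ∃ v ∈ R, PatchEq P P x (y + v) U

/-- Well-separation for a single pattern. -/
def WellSeparated (P : E → S) : Prop :=
  ∃ V : Set E, IsCompact V ∧ ∀ x y : E, P x ≠ P y →
    ∃ B ∈ 𝓝 (0 : E), ∀ b ∈ B, ∀ b' ∈ B, ¬ PatchEq P P (x + b) (y + b') V

/-- Return discreteness for a single pattern. -/
def ReturnDiscrete (P : E → S) : Prop :=
  ∃ B ∈ 𝓝 (0 : E), ∃ V : Set E, IsCompact V ∧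
    ∀ x : E, ∀ b ∈ B, PatchEq P P x (x + b) V → b = 0

/-- The translational hull of a pattern: all patterns locally indistinguishable from it. -/
def patternHull (P : E → S) : Set (E → S) := {Q | LIfrom Q P}

/-- A pattern space: a nonempty set of patterns closed under being locally
indistinguishable from the collection. -/
def IsPatternSpace (Ω : Set (E → S)) : Prop :=
  Ω.Nonempty ∧ ∀ Q : E → S,
    (∀ U : Set E, IsCompact U → ∀ x : E, ∃ R ∈ Ω, ∃ y : E, PatchEq Q R x y U) → Q ∈ Ω

/-- Finite local complexity for a pattern space. -/
def IsFLCSpace (Ω : Set (E → S)) : Prop :=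
  ∀ U : Set E, IsCompact U → ∃ (n : ℕ) (Ps : Fin n → E → S) (Ks : Fin n → Set E),
    (∀ i, IsCompact (Ks i)) ∧ ∀ Q ∈ Ω, ∀ x : E, ∃ i, ∃ y ∈ Ks i, PatchEq Q (Ps i) x y U

/-- Well-separation for a pattern space. -/
def WellSeparatedSpace (Ω : Set (E → S)) : Prop :=
  ∃ V : Set E, IsCompact V ∧ ∀ P ∈ Ω, ∀ Q ∈ Ω, P 0 ≠ Q 0 →
    ∃ B ∈ 𝓝 (0 : E), ∀ b ∈ B, ∀ b' ∈ B, ¬ PatchEq P Q b b' V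

/-- Return discreteness for a pattern space. -/
def ReturnDiscreteSpace (Ω : Set (E → S)) : Prop :=
  ∃ B ∈ 𝓝 (0 : E), ∃ V : Set E, IsCompact V ∧
    ∀ P ∈ Ω, ∀ b ∈ B, PatchEq P P 0 b V → b = 0

/-- Repetitivity for a pattern space. -/
def RepetitiveSpace (Ω : Set (E → S)) : Prop :=
  ∀ U : Set E, IsCompact U → ∃ R : Set E, IsCompact R ∧
    ∀ P ∈ Ω, ∀ Q ∈ Ω, ∃ v ∈ R, PatchEq P Q 0 v U

/-- A local derivation (LD) map between two sets of patterns. -/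
def IsLDMapOn (f : (E → S) → (E → S)) (Ω Ω' : Set (E → S)) : Prop :=
  Set.MapsTo f Ω Ω' ∧ ∃ c : ℝ, 0 ≤ c ∧
    ∀ P ∈ Ω, ∀ Q ∈ Ω, ∀ x y : E, PatchEq P Q x y (closedBall 0 c) → f P x = f Q y

/-- An expansive linear automorphism (all eigenvalues of modulus strictly greater
than `1`; equivalently, iterates expand uniformly at an exponential rate). -/
def IsExpansive (L : E ≃ₗ[ℝ] E) : Prop :=
  ∃ C > (0 : ℝ), ∃ l > (1 : ℝ), ∀ (n : ℕ) (x : E), C * l ^ n * ‖x‖ ≤ ‖(L ^ n : E ≃ₗ[ℝ] E) x‖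

/-- `P` is `L`-sub with predecessor `P'`: `P' ≼ P` and `L P' ⊳ P`. -/
def IsLSub (L : E ≃ₗ[ℝ] E) (P P' : E → S) : Prop :=
  LIfrom P' P ∧ LD (distort L P') P

/-- An `L`-sub pattern space: `Ω` together with a surjective LD (subdivision) map
`S : L Ω → Ω`. -/
def IsLSubSpace (L : E ≃ₗ[ℝ] E) (Ω : Set (E → S)) (Sub : (E → S) → (E → S)) : Prop :=
  IsLDMapOn Sub (distort L '' Ω) Ω ∧ Set.SurjOn Sub (distort L '' Ω) Ω

/-- The substitution map `σ := S ∘ L`. -/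
def substMap (L : E ≃ₗ[ℝ] E) (Sub : (E → S) → (E → S)) : (E → S) → (E → S) :=
  fun Q => Sub (distort L Q)


omit [NormedSpace ℝ E] in
lemma mem_patternHull_self (P : E → S) : P ∈ patternHull P :=
  fun _ _ x => ⟨x, fun _ _ => rfl⟩

omit [NormedSpace ℝ E] in
lemma apply_add_period {P Q : E → S} (hQ : Q ∈ patternHull P) {g : E} (hg : g ∈ periods P)
    (x : E) : Q (x + g) = Q x := by
  obtain ⟨y, hy⟩ := hQ {0, g} (Set.toFinite _).isCompact x
  have h0 := hy 0 (by simp)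
  have h1 := hy g (by simp)
  rw [add_zero, add_zero] at h0
  rw [h1, h0]
  exact hg y

/-- Well-separation passes to the hull: patches agreeing up to arbitrarily small translations
force equality at the centre. -/
lemma WellSeparated.exists_radius [FiniteDimensional ℝ E] {P : E → S} (hWS : WellSeparated P) :
    ∃ v : ℝ, 0 ≤ v ∧ ∀ A ∈ patternHull P, ∀ B ∈ patternHull P, ∀ x y : E,
      (∀ ε > 0, ∃ b b' : E, ‖b‖ < ε ∧ ‖b'‖ < ε ∧
        PatchEq A B (x + b) (y + b') (closedBall 0 v)) → A x = B y := by
  have : ProperSpace E := FiniteDimensional.proper ℝ E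
  obtain ⟨V, hV, hsep⟩ := hWS
  obtain ⟨v, hv0, hv⟩ := hV.isBounded.subset_closedBall_lt 0 0
  refine ⟨v, hv0.le, fun A hA B hB x y h => ?_⟩
  obtain ⟨p, hp⟩ := hA (closedBall 0 (v + 1)) (isCompact_closedBall _ _) x
  obtain ⟨q, hq⟩ := hB (closedBall 0 (v + 1)) (isCompact_closedBall _ _) y
  have hp0 := hp 0 (by simp; linarith)
  have hq0 := hq 0 (by simp; linarith)
  rw [add_zero, add_zero] at hp0 hq0
  rw [hp0, hq0]
  by_contra hne
  obtain ⟨W, hW, hWne⟩ := hsep p q hne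
  obtain ⟨ε, hε, hεW⟩ := Metric.mem_nhds_iff.1 hW
  obtain ⟨b, b', hb, hb', hbb⟩ := h (min ε 1) (by positivity)
  have hb1 := lt_min_iff.1 hb
  have hb2 := lt_min_iff.1 hb'
  refine hWne b (hεW (by simpa using hb1.1)) b' (hεW (by simpa using hb2.1)) ?_
  intro u hu
  have huv : ‖u‖ ≤ v := by simpa using hv hu
  have e1 := hp (b + u) (by
    rw [mem_closedBall_zero_iff]
    linarith [norm_add_le b u])
  have e2 := hq (b' + u) (by
    rw [mem_closedBall_zero_iff]
    linarith [norm_add_le b' u])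
  have e3 := hbb u (hv hu)
  rw [add_assoc, add_assoc, ← e1, ← e2, ← add_assoc, ← add_assoc, e3]

/-- An expansive automorphism has uniformly exponentially contracting inverse iterates. -/
lemma IsExpansive.exists_contraction {L : E ≃ₗ[ℝ] E} (hL : IsExpansive L) :
    ∃ M : ℝ, 0 ≤ M ∧ ∃ q : ℝ, 0 ≤ q ∧ q < 1 ∧
      ∀ (n : ℕ) (x : E), ‖(L ^ n).symm x‖ ≤ M * q ^ n * ‖x‖ := by
  obtain ⟨C, hC, l, hl, h⟩ := hL
  have hl0 : 0 < l := by linarith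
  refine ⟨C⁻¹, by positivity, l⁻¹, by positivity, inv_lt_one_of_one_lt₀ hl, fun n x => ?_⟩
  have h1 := h n ((L ^ n).symm x)
  rw [LinearEquiv.apply_symm_apply] at h1
  have h2 : 0 < C * l ^ n := by positivity
  rw [inv_pow, ← mul_inv, inv_mul_eq_div, le_div_iff₀ h2]
  linarith

lemma exists_norm_symm_pow_le {L : E ≃ₗ[ℝ] E} (hL : IsExpansive L) (R : ℝ) :
    ∃ n₀ : ℕ, ∀ n ≥ n₀, ∀ x : E, ‖x‖ ≤ R → ‖(L ^ n).symm x‖ ≤ 1 := by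
  obtain ⟨M, hM, q, hq0, hq1, h⟩ := hL.exists_contraction
  have ht : Tendsto (fun n : ℕ => M * q ^ n * R) atTop (𝓝 (M * 0 * R)) :=
    ((tendsto_pow_atTop_nhds_zero_of_lt_one hq0 hq1).const_mul M).mul_const R
  simp only [mul_zero, zero_mul] at ht
  obtain ⟨n₀, hn₀⟩ := eventually_atTop.1 (ht.eventually (ge_mem_nhds zero_lt_one))
  refine ⟨n₀, fun n hn x hx => (h n x).trans (le_trans ?_ (hn₀ n hn))⟩
  gcongr

/-- One step of the substitution is determined by patches. -/
lemma exists_substMap_radius {L : E ≃ₗ[ℝ] E} {P : E → S} {Sub : (E → S) → (E → S)}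
    (hSub : IsLDMapOn Sub (distort L '' patternHull P) (patternHull P)) :
    ∃ c : ℝ, 0 ≤ c ∧ ∀ A ∈ patternHull P, ∀ B ∈ patternHull P, ∀ x y : E,
      (∀ w : E, ‖w‖ ≤ c → A (L.symm (x + w)) = B (L.symm (y + w))) →
      substMap L Sub A x = substMap L Sub B y := by
  obtain ⟨-, c, hc, h⟩ := hSub
  refine ⟨c, hc, fun A hA B hB x y hAB => h _ ⟨A, hA, rfl⟩ _ ⟨B, hB, rfl⟩ x y fun w hw => ?_⟩
  exact hAB w (by simpa using hw)

lemma substMap_mem {L : E ≃ₗ[ℝ] E} {P : E → S} {Sub : (E → S) → (E → S)}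
    (hSub : IsLDMapOn Sub (distort L '' patternHull P) (patternHull P))
    {A : E → S} (hA : A ∈ patternHull P) : substMap L Sub A ∈ patternHull P :=
  hSub.1 ⟨A, hA, rfl⟩

lemma iterate_substMap_mem {L : E ≃ₗ[ℝ] E} {P : E → S} {Sub : (E → S) → (E → S)}
    (hSub : IsLDMapOn Sub (distort L '' patternHull P) (patternHull P))
    {A : E → S} (hA : A ∈ patternHull P) (k : ℕ) :
    (substMap L Sub)^[k] A ∈ patternHull P := by
  induction k with
  | zero => exact hA
  | succ k ih =>
    rw [Function.iterate_succ_apply']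
    exact substMap_mem hSub ih

lemma pow_succ_symm_apply (L : E ≃ₗ[ℝ] E) (k : ℕ) (x : E) :
    (L ^ (k + 1)).symm x = (L ^ k).symm (L.symm x) := by
  rw [LinearEquiv.symm_apply_eq, pow_succ', LinearEquiv.mul_apply,
    LinearEquiv.apply_symm_apply, LinearEquiv.apply_symm_apply]

/-- Iterated substitution is determined by patches, with a margin independent of the number of
iterations. -/
lemma exists_iterate_substMap_radius {L : E ≃ₗ[ℝ] E} (hL : IsExpansive L) {P : E → S}
    {Sub : (E → S) → (E → S)}
    (hSub : IsLDMapOn Sub (distort L '' patternHull P) (patternHull P)) :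
    ∃ c : ℝ, 0 ≤ c ∧ ∀ (k : ℕ), ∀ A ∈ patternHull P, ∀ B ∈ patternHull P, ∀ (a b : E) (r : ℝ),
      PatchEq A B a b (closedBall 0 r) → ∀ t : E, ‖t‖ + c ≤ r →
      (substMap L Sub)^[k] A ((L ^ k) (a + t)) = (substMap L Sub)^[k] B ((L ^ k) (b + t)) := by
  obtain ⟨M, hM, q, hq0, hq1, hcon⟩ := hL.exists_contraction
  obtain ⟨c, hc, hstep⟩ := exists_substMap_radius hSub
  have key : ∀ (k : ℕ), ∀ A ∈ patternHull P, ∀ B ∈ patternHull P, ∀ (a b : E) (r : ℝ),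
      PatchEq A B a b (closedBall 0 r) →
      ∀ t : E, ‖t‖ + ∑ i ∈ Finset.range k, M * q ^ (i + 1) * c ≤ r →
      (substMap L Sub)^[k] A ((L ^ k) (a + t)) =
        (substMap L Sub)^[k] B ((L ^ k) (b + t)) := by
    intro k A hA B hB a b r hAB
    induction k with
    | zero =>
      intro t ht
      simpa using hAB t (by simpa using ht)
    | succ k ih =>
      intro t ht
      rw [Finset.sum_range_succ] at ht
      rw [Function.iterate_succ_apply', Function.iterate_succ_apply']
      apply hstep _ (iterate_substMap_mem hSub hA k) _ (iterate_substMap_mem hSub hB k)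
      intro w hw
      have e : ∀ z : E, L.symm ((L ^ (k + 1)) (z + t) + w) =
          (L ^ k) (z + (t + (L ^ (k + 1)).symm w)) := by
        intro z
        rw [LinearEquiv.symm_apply_eq, ← LinearEquiv.mul_apply, ← pow_succ', ← add_assoc,
          map_add _ (z + t), LinearEquiv.apply_symm_apply]
      rw [e, e]
      apply ih
      have h1 := norm_add_le t ((L ^ (k + 1)).symm w)
      have h2 := hcon (k + 1) w
      have h3 : M * q ^ (k + 1) * ‖w‖ ≤ M * q ^ (k + 1) * c := by gcongr
      linarith
  have hsum : Summable fun i : ℕ => M * q ^ (i + 1) * c := by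
    have := (((summable_geometric_of_lt_one hq0 hq1).mul_right q).mul_left M).mul_right c
    simpa [pow_succ] using this
  refine ⟨∑' i : ℕ, M * q ^ (i + 1) * c, tsum_nonneg fun i => by positivity, ?_⟩
  intro k A hA B hB a b r hAB t ht
  refine key k A hA B hB a b r hAB t (le_trans ?_ ht)
  gcongr
  exact hsum.sum_le_tsum _ fun i _ => by positivity

/-- The substitution map is surjective on the hull. -/
lemma substMap_surjOn [FiniteDimensional ℝ E] (L : E ≃ₗ[ℝ] E) {P P' : E → S}
    (hFLC : IsFLC P) (hWS : WellSeparated P) (hP' : P' ∈ patternHull P)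
    {Sub : (E → S) → (E → S)}
    (hSub : IsLDMapOn Sub (distort L '' patternHull P) (patternHull P))
    (hSubP : substMap L Sub P' = P) :
    Set.SurjOn (substMap L Sub) (patternHull P) (patternHull P) := by
  have : ProperSpace E := FiniteDimensional.proper ℝ E
  intro Q hQ
  obtain ⟨v, hv0, hsep⟩ := hWS.exists_radius
  obtain ⟨c, hc, hstep⟩ := exists_substMap_radius hSub
  have hy : ∀ n : ℕ, ∃ y : E, PatchEq Q P 0 y (closedBall 0 n) :=
    fun n => hQ _ (isCompact_closedBall _ _) 0
  choose y hy using hy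
  have hK : ∀ R : ℕ, ∃ K : Set E, IsCompact K ∧ ∀ n : ℕ, ∃ p ∈ K,
      PatchEq P' P (L.symm (y n)) p (closedBall 0 R) := by
    intro R
    obtain ⟨K, hK, h⟩ := hFLC (closedBall 0 R) (isCompact_closedBall _ _)
    refine ⟨K, hK, fun n => ?_⟩
    obtain ⟨z, hz⟩ := hP' (closedBall 0 R) (isCompact_closedBall _ _) (L.symm (y n))
    obtain ⟨p, hpK, hp⟩ := h z
    exact ⟨p, hpK, fun u hu => (hz u hu).trans (hp u hu)⟩
  choose K hKc p hpK hp using hK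
  let f : Ultrafilter ℕ := hyperfilter ℕ
  have hf : (f : Filter ℕ) ≤ atTop := by
    rw [← Nat.cofinite_eq_atTop]
    exact hyperfilter_le_cofinite
  have hlim : ∀ R : ℕ, ∃ a : E, Tendsto (p R) f (𝓝 a) := by
    intro R
    obtain ⟨a, -, ha⟩ := (hKc R).ultrafilter_le_nhds (f.map (p R)) (by
      rw [Filter.le_principal_iff]
      exact Filter.mem_map.2 (Filter.univ_mem' (hpK R)))
    exact ⟨a, ha⟩
  choose a ha using hlim
  have hclose : ∀ R : ℕ, ∀ ε > 0, ∀ᶠ n in (f : Filter ℕ), ‖p R n - a R‖ < ε := by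
    intro R ε hε
    filter_upwards [(ha R).eventually (Metric.ball_mem_nhds _ hε)] with n hn
    simpa [dist_eq_norm] using hn
  have hcoh : ∀ (R R' : ℕ) (z : E), ‖z‖ + v ≤ R → ‖z‖ + v ≤ R' →
      P (a R + z) = P (a R' + z) := by
    intro R R' z hR hR'
    refine hsep P (mem_patternHull_self P) P (mem_patternHull_self P) _ _ fun ε hε => ?_
    obtain ⟨n, hn, hn'⟩ := ((hclose R ε hε).and (hclose R' ε hε)).exists
    refine ⟨_, _, hn, hn', fun u hu => ?_⟩
    rw [mem_closedBall_zero_iff] at hu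
    have hzu := norm_add_le z u
    have e1 := hp R n (z + u) (by rw [mem_closedBall_zero_iff]; linarith)
    have e2 := hp R' n (z + u) (by rw [mem_closedBall_zero_iff]; linarith)
    rw [show a R + z + (p R n - a R) + u = p R n + (z + u) by abel,
      show a R' + z + (p R' n - a R') + u = p R' n + (z + u) by abel, ← e1, ← e2]
  let T : E → S := fun z => P (a ⌈‖z‖ + v⌉₊ + z)
  have hT : ∀ (R : ℕ) (z : E), ‖z‖ + v ≤ R → T z = P (a R + z) :=
    fun R z hz => hcoh _ R z (Nat.le_ceil _) hz
  have hTmem : T ∈ patternHull P := by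
    intro W hW x
    obtain ⟨ρ, hρ⟩ := hW.isBounded.exists_norm_le
    refine ⟨a ⌈‖x‖ + ρ + v⌉₊ + x, fun u hu => ?_⟩
    have hR := Nat.le_ceil (‖x‖ + ρ + v)
    rw [hT ⌈‖x‖ + ρ + v⌉₊ (x + u) (by linarith [norm_add_le x u, hρ u hu]),
      ← add_assoc (a _)]
  refine ⟨T, hTmem, ?_⟩
  funext x
  refine (hsep Q hQ _ (substMap_mem hSub hTmem) x x fun ε hε => ?_).symm
  have hLc : Continuous L := LinearMap.continuous_of_finiteDimensional (L : E →ₗ[ℝ] E)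
  have hLsc : Continuous L.symm :=
    LinearMap.continuous_of_finiteDimensional (L.symm : E →ₗ[ℝ] E)
  obtain ⟨ρ, hρ⟩ : ∃ ρ : ℝ, ∀ z : E, ‖z‖ ≤ ‖x‖ + v + c → ‖L.symm z‖ ≤ ρ := by
    obtain ⟨ρ, hρ⟩ := ((isCompact_closedBall (0 : E) (‖x‖ + v + c)).image
      hLsc).isBounded.exists_norm_le
    exact ⟨ρ, fun z hz => hρ _ ⟨z, by simpa using hz, rfl⟩⟩
  set R : ℕ := ⌈ρ + 1 + v⌉₊ with hR
  have hRle : ρ + 1 + v ≤ R := Nat.le_ceil _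
  have hb : ∀ᶠ n in (f : Filter ℕ), ‖L (p R n - a R)‖ < ε := by
    have h1 : Tendsto (fun n => ‖L (p R n - a R)‖) f (𝓝 ‖L (a R - a R)‖) :=
      ((hLc.tendsto _).comp ((ha R).sub_const _)).norm
    rw [sub_self, map_zero, norm_zero] at h1
    exact h1.eventually (gt_mem_nhds hε)
  obtain ⟨n, ⟨hnε, hn1⟩, hnx⟩ := ((hb.and (hclose R 1 one_pos)).and
    (hf (eventually_ge_atTop ⌈‖x‖ + v⌉₊))).exists
  have hnx' : ‖x‖ + v ≤ n := (Nat.le_ceil _).trans (Nat.cast_le.2 hnx)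
  refine ⟨0, L (p R n - a R), by simpa using hε, hnε, fun u hu => ?_⟩
  rw [mem_closedBall_zero_iff] at hu
  have hQu := hy n (x + u) (by
    rw [mem_closedBall_zero_iff]
    linarith [norm_add_le x u])
  rw [zero_add] at hQu
  rw [add_zero, hQu]
  conv_lhs => rw [← hSubP]
  apply hstep _ hP' _ hTmem
  intro w hw
  have hxw : ‖L.symm (x + u + w)‖ ≤ ρ := hρ _ (by
    linarith [norm_add_le (x + u) w, norm_add_le x u])
  rw [show L.symm (y n + (x + u) + w) = L.symm (y n) + L.symm (x + u + w) by
      rw [← map_add]; congr 1; abel,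
    hp R n _ (by rw [mem_closedBall_zero_iff]; linarith),
    show L.symm (x + L (p R n - a R) + u + w) =
        L.symm (x + u + w) + (p R n - a R) by
      rw [LinearEquiv.symm_apply_eq, map_add, LinearEquiv.apply_symm_apply]; abel,
    hT R _ (by linarith [norm_add_le (L.symm (x + u + w)) (p R n - a R)])]
  congr 1
  abel

/-- The image of a subgroup under an automorphism that preserves it is cocompact in it. -/
lemma exists_norm_sub_le_of_map_le [FiniteDimensional ℝ E] (L : E ≃ₗ[ℝ] E) (G : AddSubgroup E)
    (hG : ∀ g ∈ G, L g ∈ G) :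
    ∃ D : ℝ, ∀ g ∈ G, ∃ h ∈ G, ‖g - L h‖ ≤ D := by
  obtain ⟨W, hW⟩ : ∃ W : Submodule ℝ E, W = Submodule.span ℝ (G : Set E) := ⟨_, rfl⟩
  have hmap : W.map (L : E →ₗ[ℝ] E) = W := by
    refine Submodule.eq_of_le_of_finrank_eq ?_ (LinearEquiv.finrank_map_eq L W)
    rw [hW, Submodule.map_span, Submodule.span_le]
    rintro _ ⟨g, hg, rfl⟩
    exact Submodule.subset_span (hG g hg)
  obtain ⟨f, hfG, hfspan, -⟩ := Submodule.exists_fun_fin_finrank_span_eq ℝ (G : Set E)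
  refine ⟨∑ i, ‖L (f i)‖, fun g hg => ?_⟩
  have hgW : g ∈ W.map (L : E →ₗ[ℝ] E) := by
    rw [hmap, hW]
    exact Submodule.subset_span hg
  obtain ⟨w, hw, rfl⟩ := hgW
  rw [SetLike.mem_coe, hW, ← hfspan] at hw
  obtain ⟨c, rfl⟩ := (Submodule.mem_span_range_iff_exists_fun ℝ).1 hw
  refine ⟨∑ i, ⌊c i⌋ • f i, sum_mem fun i _ => zsmul_mem (hfG i) _, ?_⟩
  have e : (L : E →ₗ[ℝ] E) (∑ i, c i • f i) - L (∑ i, ⌊c i⌋ • f i) =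
      ∑ i, Int.fract (c i) • L (f i) := by
    rw [LinearEquiv.coe_coe, ← map_sub, ← Finset.sum_sub_distrib, map_sum]
    refine Finset.sum_congr rfl fun i _ => ?_
    rw [← Int.cast_smul_eq_zsmul ℝ, ← sub_smul, map_smul, Int.self_sub_floor]
  rw [e]
  refine norm_sum_le_of_le _ fun i _ => ?_
  rw [norm_smul, Real.norm_of_nonneg (Int.fract_nonneg _)]
  exact mul_le_of_le_one_left (norm_nonneg _) (Int.fract_lt_one _).le

omit [NormedAddCommGroup E] [NormedSpace ℝ E] in
lemma exists_chain {σ : (E → S) → (E → S)} {Ω : Set (E → S)} (hσ : Set.SurjOn σ Ω Ω)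
    {P U : E → S} (hP : P ∈ Ω) (hU : U ∈ Ω) (hUP : σ U = P) :
    ∃ u : ℕ → E → S, u 0 = P ∧ u 1 = U ∧ (∀ n, u n ∈ Ω) ∧ ∀ j n, σ^[j] (u (n + j)) = u n := by
  choose! τ hτ hστ using hσ
  let u : ℕ → E → S := fun n => Nat.casesOn n P fun m => τ^[m] U
  have hmem : ∀ m, τ^[m] U ∈ Ω := by
    intro m
    induction m with
    | zero => exact hU
    | succ m ih =>
      rw [Function.iterate_succ_apply']
      exact hτ ih
  have hu : ∀ n, σ (u (n + 1)) = u n := by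
    intro n
    cases n with
    | zero => exact hUP
    | succ m =>
      change σ (τ^[m + 1] U) = τ^[m] U
      rw [Function.iterate_succ_apply']
      exact hστ (hmem m)
  refine ⟨u, rfl, rfl, fun n => ?_, fun j => ?_⟩
  · cases n with
    | zero => exact hP
    | succ m => exact hmem m
  · induction j with
    | zero => intro n; rfl
    | succ j ih =>
      intro n
      rw [Function.iterate_succ_apply, ← add_assoc, hu, ih]

/-- Any two predecessors agree on arbitrarily large balls up to a period. -/
lemma exists_period_patchEq [FiniteDimensional ℝ E] {L : E ≃ₗ[ℝ] E} (hL : IsExpansive L)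
    {P : E → S} (hFLC : IsFLC P) {Sub : (E → S) → (E → S)}
    (hSub : IsLDMapOn Sub (distort L '' patternHull P) (patternHull P))
    (hsurj : Set.SurjOn (substMap L Sub) (patternHull P) (patternHull P))
    {U V : E → S} (hU : U ∈ patternHull P) (hV : V ∈ patternHull P)
    (hUP : substMap L Sub U = P) (hVP : substMap L Sub V = P) (ρ : ℝ) :
    ∃ h ∈ periods P, ∀ z : E, ‖z‖ ≤ ρ → U z = V (z + L.symm h) := by
  have : ProperSpace E := FiniteDimensional.proper ℝ E
  have hP := mem_patternHull_self P
  obtain ⟨c, hc, hiter⟩ := exists_iterate_substMap_radius hL hSub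
  obtain ⟨A, hA0, hA1, hA, hAσ⟩ := exists_chain hsurj hP hU hUP
  obtain ⟨B, hB0, hB1, hB, hBσ⟩ := exists_chain hsurj hP hV hVP
  set r : ℝ := c + 4 with hr
  obtain ⟨K, hK, hKP⟩ := hFLC (closedBall 0 r) (isCompact_closedBall _ _)
  obtain ⟨N, hN⟩ := hK.isBounded.exists_norm_le
  have hpatch : ∀ Q ∈ patternHull P, ∀ x : E, ∃ p ∈ K, PatchEq Q P x p (closedBall 0 r) := by
    intro Q hQ x
    obtain ⟨z, hz⟩ := hQ (closedBall 0 r) (isCompact_closedBall _ _) x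
    obtain ⟨p, hpK, hp⟩ := hKP z
    exact ⟨p, hpK, fun u hu => (hz u hu).trans (hp u hu)⟩
  choose a haK ha using fun k => hpatch (A k) (hA k) 0
  choose b hbK hb using fun k => hpatch (B k) (hB k) 0
  obtain ⟨⟨a', b'⟩, -, φ, hφ, hlim⟩ := (hK.prod hK).tendsto_subseq
    (x := fun k => (a k, b k)) fun k => ⟨haK k, hbK k⟩
  have hlima : Tendsto (fun i => a (φ i)) atTop (𝓝 a') := (Prod.tendsto_iff _ _).1 hlim |>.1
  have hlimb : Tendsto (fun i => b (φ i)) atTop (𝓝 b') := (Prod.tendsto_iff _ _).1 hlim |>.2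
  have hcauchy : ∀ s : ℕ → E, ∀ l : E, Tendsto s atTop (𝓝 l) → ∀ ε > 0, ∃ i₀ : ℕ,
      ∀ i ≥ i₀, ∀ j ≥ i₀, ‖s i - s j‖ < ε := by
    intro s l hs ε hε
    obtain ⟨i₀, h⟩ := Metric.cauchySeq_iff.1 hs.cauchySeq ε hε
    exact ⟨i₀, fun i hi j hj => by simpa [dist_eq_norm] using h i hi j hj⟩
  have hshift : ∀ (C : ℕ → E → S) (s : ℕ → E),
      (∀ k, PatchEq (C k) P 0 (s k) (closedBall 0 r)) → ∀ k k', ‖s k' - s k‖ ≤ 1 →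
      PatchEq (C k') (C k) 0 (s k' - s k) (closedBall 0 (r - 1)) := by
    intro C s hs k k' hkk u hu
    rw [mem_closedBall_zero_iff] at hu
    have e1 := hs k' u (by rw [mem_closedBall_zero_iff]; linarith)
    have e2 := hs k (s k' - s k + u) (by
      rw [mem_closedBall_zero_iff]
      linarith [norm_add_le (s k' - s k) u])
    rw [e1, ← zero_add (s k' - s k + u), ← zero_add (_ - _), add_assoc, zero_add, e2]
    congr 1
    abel
  obtain ⟨i₁, hi₁⟩ := hcauchy _ _ hlima 1 one_pos
  obtain ⟨n₁, hn₁⟩ := exists_norm_symm_pow_le hL (N + r)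
  set k₁ : ℕ := φ (max i₁ n₁) with hk₁
  have hk₁n : n₁ ≤ k₁ := (le_max_right _ _).trans (hφ.id_le _)
  have hper : ∀ i > max i₁ n₁, ∀ h : E, ‖(L ^ (φ i - k₁)).symm h‖ ≤ 1 →
      (∀ t : E, ‖t‖ ≤ 2 → P ((L ^ φ i) t + h) = P ((L ^ φ i) t)) → h ∈ periods P := by
    intro i hi h hh hloc x
    set m : ℕ := φ i - k₁ with hm
    have hk : φ i = m + k₁ := by
      have := hφ hi
      omega
    set d : E := a (φ i) - a k₁ with hd
    have hd1 : ‖d‖ ≤ 1 :=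
      (hi₁ i ((le_max_left _ _).trans hi.le) _ (le_max_left _ _)).le
    have htrans : ∀ z : E, ‖z‖ ≤ N + r → A m (z - (L ^ k₁) d) = P z := by
      intro z hz
      have hz1 := hn₁ k₁ hk₁n z hz
      have := hiter k₁ _ (hA (φ i)) _ (hA k₁) _ _ _ (hshift A a ha k₁ (φ i) hd1)
        ((L ^ k₁).symm z - d) (by linarith [norm_sub_le ((L ^ k₁).symm z) d])
      have h0 := hAσ k₁ 0
      rw [zero_add, hA0] at h0
      have h1 := hAσ k₁ m
      rw [← hk] at h1
      rw [h0, h1, ← hd, zero_add, add_sub_cancel, map_sub, LinearEquiv.apply_symm_apply] at this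
      exact this
    obtain ⟨p, hpK, hp⟩ := hpatch (A m) (hA m) ((L ^ m).symm x)
    set w : E := p - (L ^ k₁) d with hw
    have hpw : PatchEq (A m) (A m) ((L ^ m).symm x) w (closedBall 0 r) := by
      intro u hu
      have hu' : ‖u‖ ≤ r := by simpa using hu
      rw [hp u hu, ← htrans (p + u) (by linarith [norm_add_le p u, hN p hpK])]
      congr 1
      rw [hw]
      abel
    have hx : ∀ t : E, ‖t‖ ≤ 1 → P (x + (L ^ m) t) = P ((L ^ m) w + (L ^ m) t) := by
      intro t ht
      have := hiter m _ (hA m) _ (hA m) _ _ _ hpw t (by linarith)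
      have h0 := hAσ m 0
      rw [zero_add, hA0] at h0
      rw [h0] at this
      simpa using this
    have hw2 : (L ^ m) w = (L ^ φ i) ((L ^ k₁).symm p - d) := by
      rw [hk, pow_add, LinearEquiv.mul_apply, map_sub (L ^ k₁), LinearEquiv.apply_symm_apply]
    have hp2 : ‖(L ^ k₁).symm p - d‖ ≤ 2 := by
      have := hn₁ k₁ hk₁n p (by linarith [hN p hpK])
      linarith [norm_sub_le ((L ^ k₁).symm p) d]
    have e1 := hx _ hh
    have e2 := hx 0 (by simp)
    rw [LinearEquiv.apply_symm_apply] at e1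
    rw [map_zero, add_zero, add_zero] at e2
    rw [e1, e2, hw2, hloc _ hp2]
  have hLc : Continuous (L ^ k₁ : E ≃ₗ[ℝ] E) :=
    LinearMap.continuous_of_finiteDimensional ((L ^ k₁ : E ≃ₗ[ℝ] E) : E →ₗ[ℝ] E)
  obtain ⟨ε, hε, hε1⟩ : ∃ ε > 0, ∀ z : E, ‖z‖ < ε → ‖(L ^ k₁) z‖ < 1 := by
    obtain ⟨ε, hε, h⟩ := Metric.continuousAt_iff.1 (hLc.continuousAt (x := 0)) 1 one_pos
    exact ⟨ε, hε, fun z hz => by simpa using h (x := z) (by simpa using hz)⟩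
  have hε' : 0 < min (ε / 2) (1 / 2) := by positivity
  obtain ⟨ia, hia⟩ := hcauchy _ _ hlima _ hε'
  obtain ⟨ib, hib⟩ := hcauchy _ _ hlimb _ hε'
  obtain ⟨n₂, hn₂⟩ := exists_norm_symm_pow_le hL ρ
  set i : ℕ := max (max ia ib) (max i₁ n₁) with hi
  set i' : ℕ := i + 1 + n₂ with hi'
  have hia' : ia ≤ i := (le_max_left _ _).trans (le_max_left _ _)
  have hib' : ib ≤ i := (le_max_right _ _).trans (le_max_left _ _)
  have hii : max i₁ n₁ ≤ i := le_max_right _ _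
  have hkk : φ i < φ i' := hφ (by omega)
  have hbig : i' ≤ φ i' := hφ.id_le _
  set da : E := a (φ i') - a (φ i) with hda
  set db : E := b (φ i') - b (φ i) with hdb
  have hda1 := lt_min_iff.1 (hia i' (by omega) i hia')
  have hdb1 := lt_min_iff.1 (hib i' (by omega) i hib')
  rw [← hda] at hda1
  rw [← hdb] at hdb1
  obtain ⟨j, hj⟩ : ∃ j, φ i' = (j + 1) + φ i := ⟨φ i' - φ i - 1, by omega⟩
  have hlevel : ∀ (C : ℕ → E → S) (s : ℕ → E), C 0 = P → (∀ n, C n ∈ patternHull P) →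
      (∀ j n, (substMap L Sub)^[j] (C (n + j)) = C n) →
      (∀ k, PatchEq (C k) P 0 (s k) (closedBall 0 r)) → ‖s (φ i') - s (φ i)‖ ≤ 1 →
      (∀ t : E, ‖t‖ ≤ 3 → C 1 ((L ^ (j + φ i)) t) = (substMap L Sub)^[j] P
        ((L ^ (j + φ i)) (s (φ i') - s (φ i) + t))) ∧
      (∀ t : E, ‖t‖ ≤ 3 → P ((L ^ φ i') t) = (substMap L Sub)^[j + 1] P
        ((L ^ φ i') (s (φ i') - s (φ i) + t))) := by
    intro C s hC0 hC hCσ hs hs1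
    have h0 := hCσ (φ i) 0
    rw [zero_add, hC0] at h0
    constructor
    · intro t ht
      have := hiter (j + φ i) _ (hC (φ i')) _ (hC (φ i)) _ _ _ (hshift C s hs _ _ hs1) t
        (by linarith)
      rw [zero_add, Function.iterate_add_apply _ _ _ (C (φ i)), h0] at this
      have h1 := hCσ (j + φ i) 1
      rw [show 1 + (j + φ i) = φ i' by omega] at h1
      rwa [h1] at this
    · intro t ht
      have := hiter (φ i') _ (hC (φ i')) _ (hC (φ i)) _ _ _ (hshift C s hs _ _ hs1) t
        (by linarith)
      have h1 := hCσ (φ i') 0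
      rw [zero_add, hC0] at h1
      rw [zero_add, h1] at this
      rw [this, hj, Function.iterate_add_apply, h0]
  obtain ⟨hUA, hPA⟩ := hlevel A a hA0 hA hAσ ha (by linarith)
  obtain ⟨hVB, hPB⟩ := hlevel B b hB0 hB hBσ hb (by linarith)
  rw [← hda, hA1] at hUA
  rw [← hdb, hB1] at hVB
  rw [← hda] at hPA
  rw [← hdb] at hPB
  have hδ : ‖da - db‖ < ε := by linarith [norm_sub_le da db]
  have hδ1 : ‖da - db‖ ≤ 1 := by linarith [norm_sub_le da db]
  have hsum : ∀ t : E, db + (t + (da - db)) = da + t := fun t => by abel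
  refine ⟨(L ^ φ i') (da - db), hper i' (by omega) _ ?_ fun t ht => ?_, fun z hz => ?_⟩
  · have : φ i' = (φ i' - k₁) + k₁ := by
      have : k₁ ≤ φ i' := hφ.monotone (by omega)
      omega
    rw [this, pow_add, LinearEquiv.mul_apply, ← this, LinearEquiv.symm_apply_apply]
    exact (hε1 _ hδ).le
  · rw [← map_add, hPB (t + (da - db)) (by linarith [norm_add_le t (da - db)]), hsum,
      hPA t (by linarith)]
  · have hz1 := hn₂ (j + φ i) (by omega) z hz
    have e1 := hUA ((L ^ (j + φ i)).symm z) (by linarith)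
    have e2 := hVB ((L ^ (j + φ i)).symm z + (da - db))
      (by linarith [norm_add_le ((L ^ (j + φ i)).symm z) (da - db)])
    rw [hsum, ← e1, LinearEquiv.apply_symm_apply, map_add, LinearEquiv.apply_symm_apply] at e2
    rw [← e2]
    congr 2
    rw [LinearEquiv.eq_symm_apply, ← LinearEquiv.mul_apply, ← pow_succ']
    congr 2
    omega

/-- Theorem (unique composition modulo `K_P`): an FLC, well-separated, expansive
`L`-sub pattern `P` satisfies UC/K: any two preimages of `P` under the substitution
map `σ = S ∘ L` on the hull of `P` have inflations differing by a period of `P`. -/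
theorem stmt0 [FiniteDimensional ℝ E] (L : E ≃ₗ[ℝ] E) (hL : IsExpansive L)
    (P P' : E → S) (hFLC : IsFLC P) (hWS : WellSeparated P) (hsub : IsLSub L P P')
    (Sub : (E → S) → (E → S))
    (hSubLD : IsLDMapOn Sub (distort L '' patternHull P) (patternHull P))
    (hSubP : Sub (distort L P') = P) :
    ∀ U ∈ patternHull P, ∀ V ∈ patternHull P,
      substMap L Sub U = P → substMap L Sub V = P →
      ∃ g ∈ periods P, distort L U = transl g (distort L V) := by
  have : ProperSpace E := FiniteDimensional.proper ℝ E
  intro U hU V hV hUP hVP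
  obtain ⟨v, hv0, hsep⟩ := hWS.exists_radius
  have hP := mem_patternHull_self P
  have hP' : P' ∈ patternHull P := hsub.1
  have hsurj := substMap_surjOn L hFLC hWS hP' hSubLD hSubP
  have hLper : ∀ g ∈ periods P, L g ∈ periods P := by
    intro g hg x
    obtain ⟨c, hc, hstep⟩ := exists_substMap_radius hSubLD
    have hσ : substMap L Sub P' = P := hSubP
    rw [← hσ]
    refine hstep _ hP' _ hP' _ _ fun w _ => ?_
    rw [show x + L g + w = x + w + L g by abel, map_add _ (x + w), LinearEquiv.symm_apply_apply]
    exact apply_add_period hP' hg _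
  obtain ⟨D, hD⟩ := exists_norm_sub_le_of_map_le L (periods P) hLper
  have hseq : ∀ n : ℕ, ∃ h ∈ periods P, ‖h‖ ≤ D ∧
      ∀ z : E, ‖z‖ ≤ n → U z = V (z + L.symm h) := by
    intro n
    obtain ⟨h, hh, hUV⟩ := exists_period_patchEq hL hFLC hSubLD hsurj hU hV hUP hVP n
    obtain ⟨g, hg, hgD⟩ := hD h hh
    refine ⟨h - L g, sub_mem hh (hLper g hg), hgD, fun z hz => ?_⟩
    rw [hUV z hz, map_sub, LinearEquiv.symm_apply_apply,
      ← apply_add_period hV hg (z + (L.symm h - g))]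
    congr 1
    abel
  choose h hper hbound hUV using hseq
  obtain ⟨g, -, φ, hφ, hlim⟩ := (isCompact_closedBall (0 : E) D).tendsto_subseq
    (x := h) fun n => by simpa using hbound n
  have hLsc : Continuous L.symm :=
    LinearMap.continuous_of_finiteDimensional (L.symm : E →ₗ[ℝ] E)
  have hsmall : ∀ ε > 0, ∀ᶠ n in atTop, ‖h (φ n) - g‖ < ε ∧ ‖L.symm (h (φ n) - g)‖ < ε := by
    intro ε hε
    have h1 : Tendsto (fun n => h (φ n) - g) atTop (𝓝 0) := by
      simpa using hlim.sub_const g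
    have h2 : Tendsto (fun n => L.symm (h (φ n) - g)) atTop (𝓝 0) := by
      have h3 := (hLsc.tendsto 0).comp h1
      rwa [map_zero] at h3
    have h1' := h1.norm
    have h2' := h2.norm
    rw [norm_zero] at h1' h2'
    exact (h1'.eventually (gt_mem_nhds hε)).and (h2'.eventually (gt_mem_nhds hε))
  have hg : g ∈ periods P := by
    intro x
    refine hsep P hP P hP _ _ fun ε hε => ?_
    obtain ⟨n, hn, -⟩ := (hsmall ε hε).exists
    refine ⟨h (φ n) - g, 0, hn, by simpa using hε, fun u _ => ?_⟩
    rw [show x + g + (h (φ n) - g) + u = x + u + h (φ n) by abel, add_zero]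
    exact hper (φ n) (x + u)
  refine ⟨-g, neg_mem hg, ?_⟩
  funext x
  change U (L.symm x) = V (L.symm (x - -g))
  refine hsep U hU V hV _ _ fun ε hε => ?_
  obtain ⟨n, ⟨-, hn⟩, hnx⟩ :=
    ((hsmall ε hε).and (eventually_ge_atTop ⌈‖L.symm x‖ + v⌉₊)).exists
  refine ⟨0, L.symm (h (φ n) - g), by simpa using hε, hn, fun u hu => ?_⟩
  rw [mem_closedBall_zero_iff] at hu
  have hnx' : ‖L.symm x‖ + v ≤ (φ n : ℕ) :=
    (Nat.le_ceil _).trans (Nat.cast_le.2 (hnx.trans (hφ.id_le n)))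
  rw [add_zero, hUV (φ n) _ (by linarith [norm_add_le (L.symm x) u])]
  congr 1
  simp only [map_sub, map_neg]
  abel
end

section
/- Let P be an FLC and return discrete pattern on E and L : E → E an expansive linear automorphism. Suppose P is L-sub, i.e., there is a pattern P' with P' ≼ P and P locally derivable from LP'. Then P' ≈ P, and the following are equivalent: (i) LP' and P are mutually locally derivable; (ii) the substitution map σ : Ω_P → Ω_P is injective; (iii) P is aperiodic, i.e., Ω_P contains no periodic elements. -/
open Metric Set Filter Topology Pointwise

variable {E : Type*} [NormedAddCommGroup E] [NormedSpace ℝ E] {S : Type*}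

set_option linter.unusedSectionVars false

/-- The `r`-ball patches of `A` at `x` and of `B` at `y` coincide. -/
def BallEq (A B : E → S) (x y : E) (r : ℝ) : Prop :=
  ∀ u : E, ‖u‖ ≤ r → A (x + u) = B (y + u)

lemma BallEq.symm {A B : E → S} {x y : E} {r : ℝ} (h : BallEq A B x y r) :
    BallEq B A y x r := fun u hu => (h u hu).symm

lemma BallEq.trans {A B C : E → S} {x y z : E} {r : ℝ} (h : BallEq A B x y r)
    (h' : BallEq B C y z r) : BallEq A C x z r := fun u hu => (h u hu).trans (h' u hu)

lemma BallEq.mono {A B : E → S} {x y : E} {r r' : ℝ} (h : BallEq A B x y r) (hr : r' ≤ r) :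
    BallEq A B x y r' := fun u hu => h u (hu.trans hr)

lemma BallEq.shift {A B : E → S} {x y : E} {r : ℝ} (h : BallEq A B x y r) (z : E) {r' : ℝ}
    (hr : ‖z‖ + r' ≤ r) : BallEq A B (x + z) (y + z) r' := by
  intro u hu
  rw [add_assoc, add_assoc]
  exact h _ ((norm_add_le _ _).trans (by linarith))

lemma BallEq.of_patchEq {A B : E → S} {x y : E} {r : ℝ}
    (h : PatchEq A B x y (closedBall 0 r)) : BallEq A B x y r :=
  fun u hu => h u (by simpa using hu)

lemma LIfrom.exists_ballEq [FiniteDimensional ℝ E] {Q P : E → S} (h : LIfrom Q P) (r : ℝ)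
    (x : E) : ∃ y, BallEq Q P x y r := by
  obtain ⟨y, hy⟩ := h _ (isCompact_closedBall (0 : E) r) x
  exact ⟨y, .of_patchEq hy⟩

lemma LIfrom.of_ballEq {Q P : E → S} (h : ∀ r : ℝ, ∀ x, ∃ y, BallEq Q P x y r) :
    LIfrom Q P := by
  intro U hU x
  obtain ⟨r, hr⟩ := hU.isBounded.exists_norm_le
  obtain ⟨y, hy⟩ := h r x
  exact ⟨y, fun u hu => hy u (hr u hu)⟩

lemma LIfrom.refl (P : E → S) : LIfrom P P := fun _ _ x => ⟨x, fun _ _ => rfl⟩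

lemma LIfrom.trans {Q P R : E → S} (h : LIfrom Q P) (h' : LIfrom P R) : LIfrom Q R := by
  intro U hU x
  obtain ⟨y, hy⟩ := h U hU x
  obtain ⟨z, hz⟩ := h' U hU y
  exact ⟨z, fun u hu => (hy u hu).trans (hz u hu)⟩

lemma LIfrom.translate {Q P : E → S} (h : LIfrom Q P) (z : E) :
    LIfrom (fun x => Q (x + z)) P := by
  intro U hU x
  obtain ⟨y, hy⟩ := h U hU (x + z)
  exact ⟨y, fun u hu => by rw [← hy u hu, add_right_comm]⟩

/-- Return discreteness of `P` with explicit radii, valid throughout the hull of `P`. -/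
def ReturnRadii (P : E → S) (ε V : ℝ) : Prop :=
  ∀ Q, LIfrom Q P → ∀ x b : E, ‖b‖ ≤ ε → BallEq Q Q x (x + b) V → b = 0

lemma ReturnDiscrete.exists_returnRadii [FiniteDimensional ℝ E] {P : E → S}
    (h : ReturnDiscrete P) : ∃ ε > 0, ∃ V, ReturnRadii P ε V := by
  obtain ⟨B, hB, K, hK, h⟩ := h
  obtain ⟨ε, hε, hεB⟩ := Metric.nhds_basis_closedBall.mem_iff.1 hB
  obtain ⟨V, hV⟩ := hK.isBounded.exists_norm_le
  refine ⟨ε, hε, V, fun Q hQ x b hb hxb => ?_⟩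
  obtain ⟨y, hy⟩ := hQ.exists_ballEq (V + ε) x
  refine h y b (hεB (by simpa using hb)) fun u hu => ?_
  have hu := hV u hu
  have h1 := hy u (by linarith)
  have h2 := hy (b + u) ((norm_add_le _ _).trans (by linarith))
  rw [← h1, hxb u hu, add_assoc, h2, add_assoc]

/-- If `A` matches `B` up to arbitrarily small translations, then it matches `B` exactly. -/
lemma ReturnRadii.ballEq_of_small {P : E → S} {ε V : ℝ} (hε : 0 < ε) (h : ReturnRadii P ε V)
    {A B : E → S} (hB : LIfrom B P) {x y : E} {r : ℝ} (hr : V ≤ r)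
    (hAB : ∀ δ > 0, ∃ t : E, ‖t‖ ≤ δ ∧ BallEq A B x (y + t) r) : BallEq A B x y r := by
  obtain ⟨t, ht, hAt⟩ := hAB (ε / 2) (by positivity)
  have key : ∀ δ > 0, ‖t‖ ≤ δ := by
    intro δ hδ
    obtain ⟨s, hs, hAs⟩ := hAB (min δ (ε / 2)) (by positivity)
    have hst : s - t = 0 := by
      refine h B hB (y + t) (s - t) ?_ ?_
      · have := hs.trans (min_le_right _ _)
        exact (norm_sub_le _ _).trans (by linarith)
      · have : y + t + (s - t) = y + s := by abel
        rw [this]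
        exact (hAt.symm.trans hAs).mono hr
    rw [sub_eq_zero] at hst
    exact hst ▸ hs.trans (min_le_left _ _)
  have ht0 : t = 0 := by
    rw [← norm_le_zero_iff]
    exact le_of_forall_pos_le_add fun δ hδ => by simpa using key δ hδ
  simpa [ht0] using hAt

lemma ReturnRadii.eq_of_small {P : E → S} {ε V : ℝ} (hε : 0 < ε) (h : ReturnRadii P ε V)
    {A B : E → S} (hB : LIfrom B P)
    (hAB : ∀ r, ∀ δ > 0, ∃ t : E, ‖t‖ ≤ δ ∧ BallEq A B 0 t r) : A = B := by
  funext x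
  have := h.ballEq_of_small hε hB (x := 0) (y := 0) (A := A) (le_max_left V ‖x‖)
    (fun δ hδ => by simpa using hAB _ δ hδ)
  simpa using this x (le_max_right _ _)

/-- `Q` is the limit of the patterns `A i` along the filter `F`. -/
def PatternLimit {ι : Type*} (F : Filter ι) (A : ι → E → S) (Q : E → S) : Prop :=
  ∀ r : ℝ, ∀ δ > 0, ∀ᶠ i in F, ∃ s : E, ‖s‖ ≤ δ ∧ BallEq Q (A i) 0 s r

lemma PatternLimit.lifrom [FiniteDimensional ℝ E] {ι : Type*} {F : Filter ι} [F.NeBot]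
    {A : ι → E → S} {Q P : E → S} (h : PatternLimit F A Q) (hA : ∀ i, LIfrom (A i) P) :
    LIfrom Q P := by
  refine LIfrom.of_ballEq fun r x => ?_
  obtain ⟨i, s, -, hs⟩ := (h (‖x‖ + r) 1 one_pos).exists
  obtain ⟨y, hy⟩ := (hA i).exists_ballEq r (s + x)
  have := hs.shift x le_rfl
  rw [zero_add] at this
  exact ⟨y, this.trans hy⟩

/-- Compactness of the hull of an FLC and return discrete pattern. -/
lemma exists_patternLimit [FiniteDimensional ℝ E] {ι : Type*} (F : Ultrafilter ι) {P : E → S}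
    (hFLC : IsFLC P) {ε V : ℝ} (hε : 0 < ε) (hRD : ReturnRadii P ε V) (A : ι → E → S)
    (hA : ∀ i, LIfrom (A i) P) : ∃ Q, PatternLimit (F : Filter ι) A Q := by
  have h1 : ∀ n : ℕ, ∃ w : E, ∀ δ > 0, ∀ᶠ i in F, ∃ v : E, ‖v - w‖ ≤ δ ∧
      BallEq (A i) P 0 v n := by
    intro n
    obtain ⟨K, hK, hKP⟩ := hFLC _ (isCompact_closedBall (0 : E) n)
    have : ∀ i, ∃ v ∈ K, BallEq (A i) P 0 v n := by
      intro i
      obtain ⟨y, hy⟩ := (hA i).exists_ballEq n 0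
      obtain ⟨v, hv, hyv⟩ := hKP y
      exact ⟨v, hv, hy.trans (.of_patchEq hyv)⟩
    choose v hvK hv using this
    obtain ⟨w, -, hw⟩ := hK.ultrafilter_le_nhds (F.map v)
      (tendsto_principal.2 (.of_forall hvK))
    refine ⟨w, fun δ hδ => ?_⟩
    have hw' : Tendsto v F (𝓝 w) := hw
    filter_upwards [hw'.eventually (Metric.closedBall_mem_nhds w hδ)] with i hi
    exact ⟨v i, by simpa [dist_eq_norm] using hi, hv i⟩
  choose w hw using h1
  have cons : ∀ n m : ℕ, V + 1 ≤ n → n ≤ m → BallEq P P (w n) (w m) (n - 1) := by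
    intro n m hn hnm
    have hnm' : (n : ℝ) ≤ m := by exact_mod_cast hnm
    refine hRD.ballEq_of_small hε (LIfrom.refl P) (by linarith) fun δ hδ => ?_
    obtain ⟨i, ⟨v, hv, hvA⟩, ⟨v', hv', hvA'⟩⟩ :=
      ((hw n (min (δ / 2) 1) (by positivity)).and (hw m (min (δ / 2) 1) (by positivity))).exists
    have h1 := hv.trans (min_le_left _ _)
    have h2 := hv.trans (min_le_right _ _)
    have h3 := hv'.trans (min_le_left _ _)
    refine ⟨(v' - w m) - (v - w n), (norm_sub_le _ _).trans (by linarith), ?_⟩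
    have := (hvA.symm.trans (hvA'.mono hnm')).shift (-(v - w n)) (r' := n - 1)
      (by rw [norm_neg]; linarith)
    convert this using 1 <;> abel
  let N : E → ℕ := fun x => ⌈‖x‖ + |V|⌉₊ + 2
  have hN : ∀ x, ‖x‖ + |V| + 2 ≤ N x := fun x => by
    have := Nat.le_ceil (‖x‖ + |V|)
    simp only [N]; push_cast; linarith
  have key : ∀ n : ℕ, V + 1 ≤ n → BallEq (fun x => P (w (N x) + x)) P 0 (w n) (n - 1) := by
    intro n hn u hu
    have := hN u
    have hV := le_abs_self V
    have hV' := abs_nonneg V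
    have hu0 := norm_nonneg u
    simp only [zero_add]
    rcases le_total (N u) n with hle | hle
    · exact cons _ _ (by linarith) hle u (by linarith)
    · exact (cons _ _ hn hle u hu).symm
  refine ⟨fun x => P (w (N x) + x), fun r δ hδ => ?_⟩
  obtain ⟨n, hn⟩ := exists_nat_ge (|V| + |r| + 1)
  have hV := le_abs_self V
  have hr := le_abs_self r
  have hV' := abs_nonneg V
  have hr' := abs_nonneg r
  filter_upwards [hw n (min δ 1) (by positivity)] with i hi
  obtain ⟨v, hv, hvA⟩ := hi
  have h2 := hv.trans (min_le_right _ _)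
  refine ⟨-(v - w n), by rw [norm_neg]; exact hv.trans (min_le_left _ _), ?_⟩
  have h3 := hvA.shift (-(v - w n)) (r' := n - 1) (by rw [norm_neg]; linarith)
  have e : v + -(v - w n) = w n := by abel
  rw [e, zero_add] at h3
  exact ((key n (by linarith)).trans h3.symm).mono (by linarith)

/-- Finitely many points represent all `r`-patches of the hull up to translations of length
at most `1`. -/
lemma IsFLC.exists_finset [FiniteDimensional ℝ E] {P : E → S} (hFLC : IsFLC P) (r : ℝ) :
    ∃ t : Finset E, ∀ Q, LIfrom Q P → ∀ x, ∃ v ∈ t, ∃ e : E, ‖e‖ ≤ 1 ∧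
      BallEq Q P (x + e) v r := by
  obtain ⟨K, hK, hKP⟩ := hFLC _ (isCompact_closedBall (0 : E) (1 + r))
  obtain ⟨t, -, ht, hKt⟩ := hK.finite_cover_balls (e := 1) one_pos
  lift t to Finset E using ht
  refine ⟨t, fun Q hQ x => ?_⟩
  obtain ⟨y, hy⟩ := hQ.exists_ballEq (1 + r) x
  obtain ⟨v, hv, hyv⟩ := hKP y
  obtain ⟨z, hz, hvz⟩ := mem_iUnion₂.1 (hKt hv)
  rw [mem_ball, dist_eq_norm] at hvz
  have hzv : ‖z - v‖ ≤ 1 := by rw [norm_sub_rev]; exact hvz.le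
  refine ⟨z, hz, z - v, hzv, ?_⟩
  have := (hy.trans (.of_patchEq hyv)).shift (z - v) (r' := r) (by linarith)
  simpa using this

lemma IsFLC.exists_bound [FiniteDimensional ℝ E] {P : E → S} (hFLC : IsFLC P) {Q : E → S}
    (hQ : LIfrom Q P) (r : ℝ) : ∃ ρ : ℝ, ∀ x, ∃ v : E, ‖v‖ ≤ ρ ∧ BallEq Q Q x v r := by
  classical
  obtain ⟨t, ht⟩ := hFLC.exists_finset (1 + r)
  let f : E → E := fun v => if h : ∃ y, BallEq Q P y v (1 + r) then h.choose else 0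
  refine ⟨(∑ v ∈ t, ‖f v‖) + 1, fun x => ?_⟩
  obtain ⟨v, hv, e, he, hxv⟩ := ht Q hQ x
  have hex : ∃ y, BallEq Q P y v (1 + r) := ⟨_, hxv⟩
  have hf : BallEq Q P (f v) v (1 + r) := by
    simp only [f, dif_pos hex]
    exact hex.choose_spec
  refine ⟨f v + -e, (norm_add_le _ _).trans ?_, ?_⟩
  · rw [norm_neg]
    exact add_le_add (Finset.single_le_sum (f := fun v => ‖f v‖)
      (fun _ _ => norm_nonneg _) hv) he
  · have := (hxv.trans hf.symm).shift (-e) (r' := r) (by rw [norm_neg]; linarith)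
    simpa using this

/-- `σ A` at `L a` depends only on the values of `A` on `a + L⁻¹ B_c`. -/
def IsLocalRule (L : E ≃ₗ[ℝ] E) (c : ℝ) (Ω : Set (E → S)) (σ : (E → S) → (E → S)) : Prop :=
  ∀ A ∈ Ω, ∀ B ∈ Ω, ∀ a b : E,
    (∀ u, ‖u‖ ≤ c → A (a + L.symm u) = B (b + L.symm u)) → σ A (L a) = σ B (L b)

/-- The `m`-th iterate of `σ` at `L ^ m a` depends only on the `r`-patch at `a`, where `r` is
independent of `m`. -/
def IsIterRule (L : E ≃ₗ[ℝ] E) (r : ℝ) (Ω : Set (E → S)) (σ : (E → S) → (E → S)) : Prop :=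
  ∀ (m : ℕ) (A B : E → S), (∀ k < m, σ^[k] A ∈ Ω) → (∀ k < m, σ^[k] B ∈ Ω) → ∀ a b : E,
    BallEq A B a b r → σ^[m] A ((L ^ m) a) = σ^[m] B ((L ^ m) b)

lemma LinearEquiv.pow_succ_apply' (L : E ≃ₗ[ℝ] E) (m : ℕ) (a : E) :
    (L ^ (m + 1)) a = L ((L ^ m) a) := by
  rw [pow_succ', LinearEquiv.mul_apply]

lemma LinearEquiv.exists_norm_le [FiniteDimensional ℝ E] (L : E ≃ₗ[ℝ] E) :
    ∃ M > 0, ∀ x, ‖L x‖ ≤ M * ‖x‖ := by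
  obtain ⟨M, hM, h⟩ := (L.toContinuousLinearEquiv : E →L[ℝ] E).isBoundedLinearMap.bound
  exact ⟨M, hM, h⟩

lemma LinearEquiv.norm_pow_symm_le {L : E ≃ₗ[ℝ] E} {C l : ℝ} (hC : 0 < C) (hl : 1 < l)
    (hL : ∀ (n : ℕ) (x : E), C * l ^ n * ‖x‖ ≤ ‖(L ^ n : E ≃ₗ[ℝ] E) x‖) (n : ℕ) (u : E) :
    ‖(L ^ n).symm u‖ ≤ C⁻¹ * (l⁻¹) ^ n * ‖u‖ := by
  have h := hL n ((L ^ n).symm u)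
  rw [LinearEquiv.apply_symm_apply] at h
  have hl0 : 0 < l := by linarith
  rw [inv_pow, ← mul_inv, inv_mul_eq_div, le_div_iff₀ (by positivity)]
  linarith

lemma IsLocalRule.exists_isIterRule {L : E ≃ₗ[ℝ] E} (hL : IsExpansive L) {c : ℝ} (hc : 0 ≤ c)
    {Ω : Set (E → S)} {σ : (E → S) → (E → S)} (hσ : IsLocalRule L c Ω σ) :
    ∃ r, IsIterRule L r Ω σ := by
  obtain ⟨C, hC, l, hl, hL⟩ := hL
  have hl0 : 0 < l := by linarith
  have key : ∀ (m : ℕ) (A B : E → S), (∀ k < m, σ^[k] A ∈ Ω) → (∀ k < m, σ^[k] B ∈ Ω) →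
      ∀ a b : E, BallEq A B a b (∑ j ∈ Finset.range m, C⁻¹ * (l⁻¹) ^ (j + 1) * c) →
      σ^[m] A ((L ^ m) a) = σ^[m] B ((L ^ m) b) := by
    intro m
    induction m with
    | zero =>
      intro A B _ _ a b h
      simpa using h 0 (by simp)
    | succ m ih =>
      intro A B hA hB a b h
      rw [Function.iterate_succ_apply', Function.iterate_succ_apply',
        LinearEquiv.pow_succ_apply', LinearEquiv.pow_succ_apply']
      refine hσ _ (hA m m.lt_succ_self) _ (hB m m.lt_succ_self) _ _ fun u hu => ?_
      set w := (L ^ (m + 1)).symm u with hw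
      have hLw : L.symm u = (L ^ m) w := by
        rw [LinearEquiv.symm_apply_eq, ← LinearEquiv.pow_succ_apply', hw,
          LinearEquiv.apply_symm_apply]
      rw [hLw, ← map_add, ← map_add]
      refine ih A B (fun k hk => hA k (by lia)) (fun k hk => hB k (by lia)) _ _
        (h.shift w ?_)
      rw [Finset.sum_range_succ, add_comm]
      have h1 := LinearEquiv.norm_pow_symm_le hC hl hL (m + 1) u
      have h2 : C⁻¹ * (l⁻¹) ^ (m + 1) * ‖u‖ ≤ C⁻¹ * (l⁻¹) ^ (m + 1) * c := by gcongr
      linarith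
  have hsum : Summable fun j : ℕ => C⁻¹ * (l⁻¹) ^ (j + 1) * c := by
    have := summable_geometric_of_lt_one (inv_nonneg.2 hl0.le) (inv_lt_one_of_one_lt₀ hl)
    exact (((summable_nat_add_iff 1).2 this).mul_left _).mul_right _
  have hnn : ∀ j : ℕ, 0 ≤ C⁻¹ * (l⁻¹) ^ (j + 1) * c := fun j => by positivity
  exact ⟨∑' j : ℕ, C⁻¹ * (l⁻¹) ^ (j + 1) * c, fun m A B hA hB a b h =>
    key m A B hA hB a b (h.mono (hsum.sum_le_tsum _ fun j _ => hnn j))⟩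

lemma IsIterRule.apply_add {L : E ≃ₗ[ℝ] E} {r : ℝ} {Ω : Set (E → S)}
    {σ : (E → S) → (E → S)} (hσ : IsIterRule L r Ω σ) {m : ℕ} {A B : E → S}
    (hA : ∀ k < m, σ^[k] A ∈ Ω) (hB : ∀ k < m, σ^[k] B ∈ Ω) {a b : E} {ρ : ℝ}
    (h : BallEq A B a b (ρ + r)) {z : E} (hz : ‖z‖ ≤ ρ) :
    σ^[m] A ((L ^ m) (a + z)) = σ^[m] B ((L ^ m) (b + z)) :=
  hσ m A B hA hB _ _ (h.shift z (by linarith))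

lemma IsIterRule.apply_one {L : E ≃ₗ[ℝ] E} {r : ℝ} {Ω : Set (E → S)}
    {σ : (E → S) → (E → S)} (hσ : IsIterRule L r Ω σ) {A B : E → S}
    (hA : A ∈ Ω) (hB : B ∈ Ω) {a b : E} {ρ : ℝ}
    (h : BallEq A B a b (ρ + r)) {z : E} (hz : ‖L.symm z‖ ≤ ρ) :
    σ A (L a + z) = σ B (L b + z) := by
  have := hσ.apply_add (m := 1) (A := A) (B := B) (fun k hk => by simpa [Nat.lt_one_iff.1 hk])
    (fun k hk => by simpa [Nat.lt_one_iff.1 hk]) h hz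
  simpa using this

lemma IsIterRule.map_translate {L : E ≃ₗ[ℝ] E} {r : ℝ} {Ω : Set (E → S)}
    {σ : (E → S) → (E → S)} (hσ : IsIterRule L r Ω σ) {A : E → S} (hA : A ∈ Ω) (h : E)
    (hAh : (fun x => A (x + h)) ∈ Ω) :
    σ (fun x => A (x + h)) = fun x => σ A (x + L h) := by
  funext x
  have := hσ.apply_one hAh hA (a := 0) (b := h) (ρ := ‖L.symm x‖) (z := x)
    (fun u _ => by simp [add_comm]) le_rfl
  rw [add_comm (L h)] at this
  simpa using this

lemma eventually_hyperfilter_ge (r : ℝ) : ∀ᶠ n : ℕ in (hyperfilter ℕ : Filter ℕ), r ≤ n :=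
  (tendsto_natCast_atTop_atTop.eventually_ge_atTop r).filter_mono Nat.hyperfilter_le_atTop

/-- A local rule maps limits of patterns to limits of the images. -/
lemma IsIterRule.patternLimit [FiniteDimensional ℝ E] {L : E ≃ₗ[ℝ] E} {r : ℝ}
    {Ω : Set (E → S)} {σ : (E → S) → (E → S)} (hσ : IsIterRule L r Ω σ) {ι : Type*}
    {F : Filter ι} {A : ι → E → S} {Q : E → S} (hA : ∀ i, A i ∈ Ω) (hQ : Q ∈ Ω)
    {ρ δ : ℝ} (hδ : 0 < δ) (h : PatternLimit F A Q) :
    ∀ᶠ i in F, ∃ s : E, ‖s‖ ≤ δ ∧ BallEq Q (A i) 0 s δ ∧ ‖L s‖ ≤ δ ∧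
      BallEq (σ Q) (σ (A i)) 0 (L s) ρ := by
  obtain ⟨M, hM, hLM⟩ := L.exists_norm_le
  obtain ⟨M', hM', hLM'⟩ := L.symm.exists_norm_le
  filter_upwards [h (max (M' * ρ + r) δ) (min δ (δ / M)) (by positivity)] with i hi
  obtain ⟨s, hs, hQs⟩ := hi
  refine ⟨s, hs.trans (min_le_left _ _), hQs.mono (le_max_right _ _), ?_, fun u hu => ?_⟩
  · have := hs.trans (min_le_right _ _)
    rw [le_div_iff₀ hM] at this
    linarith [hLM s]
  · have := hσ.apply_one hQ (hA i) (hQs.mono (le_max_left _ _)) (z := u)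
      ((hLM' u).trans (by gcongr))
    simpa using this

/-- Every pattern locally indistinguishable from `σ A₀` is the image of a pattern locally
indistinguishable from `A₀`. -/
lemma IsIterRule.exists_preimage [FiniteDimensional ℝ E] {L : E ≃ₗ[ℝ] E} {r : ℝ}
    {Ω : Set (E → S)} {σ : (E → S) → (E → S)} (hσ : IsIterRule L r Ω σ) {P : E → S}
    (hFLC : IsFLC P) {ε V : ℝ} (hε : 0 < ε) (hRD : ReturnRadii P ε V)
    {A₀ : E → S} (hA₀ : ∀ A, LIfrom A A₀ → A ∈ Ω) (hA₀P : LIfrom A₀ P)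
    {B : E → S} (hB : LIfrom B (σ A₀)) (hBP : LIfrom B P) :
    ∃ A, LIfrom A A₀ ∧ σ A = B := by
  have : ∀ n : ℕ, ∃ y, BallEq B (σ A₀) 0 y n := fun n => hB.exists_ballEq n 0
  choose y hy using this
  have hA : ∀ n, LIfrom (fun x => A₀ (x + L.symm (y n))) A₀ :=
    fun n => (LIfrom.refl A₀).translate _
  obtain ⟨Q, hQ⟩ := exists_patternLimit (hyperfilter ℕ) hFLC hε hRD _
    (fun n => (hA n).trans hA₀P)
  have hQA := hQ.lifrom hA
  refine ⟨Q, hQA, hRD.eq_of_small hε hBP fun ρ δ hδ => ?_⟩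
  obtain ⟨n, ⟨s, -, -, hs, hQs⟩, hn⟩ := ((hσ.patternLimit (fun n => hA₀ _ (hA n)) (hA₀ _ hQA)
    (ρ := ρ) hδ hQ).and (eventually_hyperfilter_ge (δ + ρ))).exists
  refine ⟨L s, hs, fun u hu => ?_⟩
  rw [hQs u hu, hσ.map_translate (hA₀ _ (LIfrom.refl A₀)) _ (hA₀ _ (hA n)),
    LinearEquiv.apply_symm_apply]
  have := hy n (L s + u) ((norm_add_le _ _).trans (by linarith))
  rw [zero_add] at this
  rw [this]
  exact congrArg _ (add_comm _ _)

lemma iterate_mem_patternHull {P : E → S} {σ : (E → S) → (E → S)}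
    (hσ : MapsTo σ (patternHull P) (patternHull P)) {A : E → S} (hA : LIfrom A P) (k : ℕ) :
    LIfrom (σ^[k] A) P := hσ.iterate k hA

/-- Local periods of bounded length on arbitrarily large regions, after applying powers of
the substitution, give a periodic element of the hull. -/
lemma IsIterRule.exists_periodic [FiniteDimensional ℝ E] {L : E ≃ₗ[ℝ] E} {r : ℝ}
    {P : E → S} {σ : (E → S) → (E → S)} (hσ : IsIterRule L r (patternHull P) σ)
    (hmaps : MapsTo σ (patternHull P) (patternHull P))
    (hFLC : IsFLC P) {ε V : ℝ} (hε : 0 < ε) (hRD : ReturnRadii P ε V)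
    (h : ∀ R : ℕ, ∃ A, LIfrom A P ∧ ∃ (m : ℕ) (y b : E), b ≠ 0 ∧ ‖b‖ ≤ 1 ∧ ∀ z : E, ‖z‖ ≤ R →
      σ^[m] A ((L ^ m) (y + z)) = σ^[m] A ((L ^ m) (y + b + z))) :
    ∃ Q, LIfrom Q P ∧ ∃ g : E, g ≠ 0 ∧ ∀ x, Q (x + g) = Q x := by
  choose A hA m y b hb hb1 hper using h
  obtain ⟨Q, hQ⟩ := exists_patternLimit (hyperfilter ℕ) hFLC hε hRD
    (fun n x => A n (x + y n)) fun n => (hA n).translate _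
  have hQP : LIfrom Q P := hQ.lifrom fun n => (hA n).translate _
  obtain ⟨ρ, hρ⟩ := hFLC.exists_bound hQP (1 + r)
  obtain ⟨n, ⟨s, hs, hQs⟩, hn⟩ :=
    ((hQ (ρ + (1 + r)) 1 one_pos).and (eventually_hyperfilter_ge (1 + ρ))).exists
  have hQA : BallEq Q (A n) 0 (s + y n) (ρ + (1 + r)) := fun u hu => by
    rw [hQs u hu]
    show A n (s + u + y n) = _
    rw [add_right_comm]
  have hitQ := fun (k : ℕ) (_ : k < m n) => iterate_mem_patternHull hmaps hQP k
  have hitA := fun (k : ℕ) (_ : k < m n) => iterate_mem_patternHull hmaps (hA n) k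
  refine ⟨σ^[m n] Q, iterate_mem_patternHull hmaps hQP _, (L ^ m n) (b n), by simpa using hb n,
    fun x => ?_⟩
  obtain ⟨x, rfl⟩ := (L ^ m n).surjective x
  obtain ⟨v, hv, hxv⟩ := hρ x
  have h1 := hQA.shift v (r' := 1 + r) (by linarith)
  rw [zero_add] at h1
  have h2 := hσ.apply_add hitQ hitA (hxv.trans h1) (hb1 n)
  have h3 := hσ.apply_add hitQ hitA (hxv.trans h1) (z := 0) (ρ := 1) (by simp)
  have h4 := hper n (s + v) ((norm_add_le _ _).trans (by linarith))
  rw [← map_add, h2]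
  rw [add_zero, add_zero] at h3
  rw [h3]
  have e1 : s + y n + v + b n = y n + b n + (s + v) := by abel
  have e2 : s + y n + v = y n + (s + v) := by abel
  rw [e1, e2, h4]

/-- A local derivation `L P' ⊳ P` extends to a local rule on the hull of `P'`. -/
lemma LD.exists_isLocalRule [FiniteDimensional ℝ E] {L : E ≃ₗ[ℝ] E} {P P' : E → S}
    (h : LD (distort L P') P) :
    ∃ σ c, 0 ≤ c ∧ IsLocalRule L c (patternHull P') σ ∧ σ P' = P := by
  classical
  obtain ⟨c, hc, h⟩ := h
  obtain ⟨M, hM, hLM⟩ := L.symm.exists_norm_le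
  have hld : ∀ a b : E, (∀ u, ‖u‖ ≤ c → P' (a + L.symm u) = P' (b + L.symm u)) →
      P (L a) = P (L b) := fun a b hab => by
    refine h _ _ fun u hu => ?_
    simpa [distort] using hab u (by simpa using hu)
  have hex : ∀ A ∈ patternHull P', ∀ a : E, ∃ b : E, ∀ u, ‖u‖ ≤ c →
      A (a + L.symm u) = P' (b + L.symm u) := fun A hA a => by
    obtain ⟨b, hb⟩ := LIfrom.exists_ballEq hA (M * c) a
    exact ⟨b, fun u hu => hb _ ((hLM u).trans (by gcongr))⟩
  have hval : ∀ A : E → S, ∃ B : E → S, A ∈ patternHull P' → ∀ a b : E,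
      (∀ u, ‖u‖ ≤ c → A (a + L.symm u) = P' (b + L.symm u)) → B (L a) = P (L b) := by
    intro A
    by_cases hA : A ∈ patternHull P'
    · choose f hf using hex A hA
      refine ⟨fun x => P (L (f (L.symm x))), fun _ a b hab => hld _ _ fun u hu => ?_⟩
      rw [LinearEquiv.symm_apply_apply, ← hf a u hu, hab u hu]
    · exact ⟨A, fun hA' => absurd hA' hA⟩
  choose σ hσ using hval
  refine ⟨σ, c, hc, fun A hA B hB a b hab => ?_, ?_⟩
  · obtain ⟨a', ha'⟩ := hex A hA a
    rw [hσ A hA a a' ha', hσ B hB b a' fun u hu => (hab u hu).symm.trans (ha' u hu)]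
  · funext x
    obtain ⟨a, rfl⟩ := L.surjective x
    exact hσ P' (LIfrom.refl P') a a fun _ _ => rfl

lemma IsLDMapOn.exists_isLocalRule {L : E ≃ₗ[ℝ] E} {P : E → S} {Sub : (E → S) → (E → S)}
    {Ω : Set (E → S)} (h : IsLDMapOn Sub (distort L '' patternHull P) Ω) :
    ∃ c, 0 ≤ c ∧ IsLocalRule L c (patternHull P) (substMap L Sub) := by
  obtain ⟨-, c, hc, h⟩ := h
  refine ⟨c, hc, fun A hA B hB a b hab => ?_⟩
  refine h _ (mem_image_of_mem _ hA) _ (mem_image_of_mem _ hB) _ _ fun u hu => ?_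
  simpa [distort] using hab u (by simpa using hu)

/-- An infinite chain of predecessors, each locally indistinguishable from the previous one. -/
lemma IsIterRule.exists_chain [FiniteDimensional ℝ E] {L : E ≃ₗ[ℝ] E} {r : ℝ}
    {P P' : E → S} {σ : (E → S) → (E → S)} (hσ : IsIterRule L r (patternHull P') σ)
    (hFLC : IsFLC P) {ε V : ℝ} (hε : 0 < ε) (hRD : ReturnRadii P ε V) (hP' : LIfrom P' P)
    (hσP : σ P' = P) :
    ∃ p : ℕ → E → S, p 0 = P ∧ p 1 = P' ∧ ∀ n, σ (p (n + 1)) = p n ∧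
      LIfrom (p (n + 1)) (p n) ∧ LIfrom (p (n + 1)) P' := by
  let T := {q : (E → S) × (E → S) // σ q.2 = q.1 ∧ LIfrom q.2 q.1 ∧ LIfrom q.2 P'}
  have step : ∀ q : T, ∃ q' : T, q'.1.1 = q.1.2 := by
    rintro ⟨⟨B, A⟩, h1, h2, h3⟩
    obtain ⟨A', hA', hσA'⟩ := hσ.exists_preimage hFLC hε hRD (A₀ := A) (B := A)
      (fun C hC => LIfrom.trans hC h3) (h3.trans hP') (by rw [h1]; exact h2) (h3.trans hP')
    exact ⟨⟨(A, A'), hσA', hA', hA'.trans h3⟩, rfl⟩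
  choose f hf using step
  let q₀ : T := ⟨(P, P'), hσP, hP', LIfrom.refl P'⟩
  have hsucc : ∀ n, (f^[n + 1] q₀).1.1 = (f^[n] q₀).1.2 := fun n => by
    rw [Function.iterate_succ_apply', hf]
  refine ⟨fun n => (f^[n] q₀).1.1, rfl, hsucc 0, fun n => ?_⟩
  simp only [hsucc]
  exact (f^[n] q₀).2

lemma IsLSub.lifrom [FiniteDimensional ℝ E] {L : E ≃ₗ[ℝ] E} (hL : IsExpansive L)
    {P P' : E → S} (hFLC : IsFLC P) {ε V : ℝ} (hε : 0 < ε) (hRD : ReturnRadii P ε V)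
    (hsub : IsLSub L P P') : LIfrom P P' := by
  classical
  obtain ⟨σ, c, hc, hloc, hσP⟩ := hsub.2.exists_isLocalRule
  obtain ⟨r, hσ⟩ := hloc.exists_isIterRule hL hc
  obtain ⟨p, hp0, hp1, hp⟩ := hσ.exists_chain hFLC hε hRD hsub.1 hσP
  obtain ⟨C, hC, l, hl, hL⟩ := hL
  have hpP : ∀ n, LIfrom (p n) P := by
    rintro (_ | n)
    · exact hp0 ▸ LIfrom.refl P
    · exact (hp n).2.2.trans hsub.1
  have hiter : ∀ k n, σ^[k] (p (n + k)) = p n := by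
    intro k
    induction k with
    | zero => intro n; rfl
    | succ k ih => intro n; rw [Function.iterate_succ_apply, ← add_assoc, (hp _).1, ih]
  have hmem : ∀ n k, k < n → LIfrom (σ^[k] (p n)) P' := by
    intro n k hk
    obtain ⟨j, rfl⟩ := Nat.exists_eq_add_of_lt hk
    rw [show k + j + 1 = (j + 1) + k by ring, hiter]
    exact (hp j).2.2
  obtain ⟨t, ht⟩ := hFLC.exists_finset (1 + (1 + r))
  let I : ℕ → Finset E := fun n => t.filter fun v => ∃ y, BallEq (p n) P y v (1 + (1 + r))
  have hI : ∀ n, I (n + 1) ≤ I n := by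
    intro n v hv
    obtain ⟨hvt, y, hy⟩ := Finset.mem_filter.1 hv
    obtain ⟨z, hz⟩ := (hp n).2.1.exists_ballEq (1 + (1 + r)) y
    exact Finset.mem_filter.2 ⟨hvt, z, hz.symm.trans hy⟩
  obtain ⟨N, hN⟩ := WellFoundedLT.antitone_chain_condition (antitone_nat_of_succ_le hI)
  refine LIfrom.of_ballEq fun R x => ?_
  obtain ⟨k, hk⟩ := pow_unbounded_of_one_lt (C⁻¹ * R) hl
  set n := N + k with hn
  have hsmall : ∀ u : E, ‖u‖ ≤ R → ‖(L ^ n).symm u‖ ≤ 1 := by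
    intro u hu
    refine (LinearEquiv.norm_pow_symm_le hC hl hL n u).trans ?_
    have hl0 : 0 < l := by linarith
    have h1 : C⁻¹ * ‖u‖ ≤ C⁻¹ * R := by gcongr
    have h2 : l ^ k ≤ l ^ n := pow_le_pow_right₀ hl.le (by lia)
    rw [inv_pow, mul_right_comm, ← div_eq_mul_inv, div_le_one (by positivity)]
    linarith
  obtain ⟨a, rfl⟩ := (L ^ n).surjective x
  obtain ⟨v, hv, e, he, hav⟩ := ht _ (hpP n) a
  have hvI : v ∈ I (n + 1) := by
    rw [← hN (n + 1) (by lia), hN n (by lia)]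
    exact Finset.mem_filter.2 ⟨hv, _, hav⟩
  obtain ⟨-, y, hy⟩ := Finset.mem_filter.1 hvI
  have h1 := (hav.trans hy.symm).shift (-e) (r' := 1 + r) (by rw [norm_neg]; linarith)
  rw [add_neg_cancel_right] at h1
  refine ⟨(L ^ n) (y + -e), fun u hu => ?_⟩
  have h2 := hσ.apply_add (fun k hk => hmem n k hk) (fun k hk => hmem (n + 1) k (by lia)) h1
    (hsmall u hu)
  have h3 := hiter n 0
  have h4 := hiter n 1
  rw [zero_add] at h3
  rw [add_comm] at h4
  rwa [h3, h4, hp0, hp1, map_add, map_add, LinearEquiv.apply_symm_apply] at h2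

lemma IsIterRule.injOn_of_ld [FiniteDimensional ℝ E] {L : E ≃ₗ[ℝ] E} {r : ℝ}
    {P P' : E → S} {σ : (E → S) → (E → S)} (hσ : IsIterRule L r (patternHull P) σ)
    (hP' : LIfrom P' P) (hP : LIfrom P P') (hσP : σ P' = P) (hld : LD P (distort L P')) :
    InjOn σ (patternHull P) := by
  obtain ⟨c, hc, hld⟩ := hld
  obtain ⟨M, hM, hLM⟩ := L.symm.exists_norm_le
  have hr0 : 0 ≤ |r| := abs_nonneg r
  have hr : r ≤ |r| := le_abs_self r
  have hMc : 0 ≤ M * c := by positivity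
  intro A hA B hB hAB
  funext x
  obtain ⟨a, ha⟩ := (LIfrom.trans hA hP).exists_ballEq (M * c + |r|) x
  obtain ⟨b, hb⟩ := (LIfrom.trans hB hP).exists_ballEq (M * c + |r|) x
  have key := hld (L a) (L b) fun u hu => by
    have hu' : ‖L.symm u‖ ≤ M * c := (hLM u).trans (by gcongr; simpa using hu)
    rw [← hσP, ← hσ.apply_one hA hP' (ha.mono (by linarith)) hu',
      ← hσ.apply_one hB hP' (hb.mono (by linarith)) hu', hAB]
  have h1 := ha 0 (by simp; positivity)
  have h2 := hb 0 (by simp; positivity)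
  simp only [add_zero] at h1 h2
  rw [h1, h2]
  simpa [distort] using key

lemma IsIterRule.ld_of_injOn [FiniteDimensional ℝ E] {L : E ≃ₗ[ℝ] E} {r : ℝ}
    {P P' : E → S} {σ : (E → S) → (E → S)} (hσ : IsIterRule L r (patternHull P) σ)
    (hmaps : MapsTo σ (patternHull P) (patternHull P))
    (hFLC : IsFLC P) {ε V : ℝ} (hε : 0 < ε) (hRD : ReturnRadii P ε V)
    (hP' : LIfrom P' P) (hσP : σ P' = P) (hinj : InjOn σ (patternHull P)) :
    LD P (distort L P') := by
  by_contra hcon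
  have : ∀ n : ℕ, ∃ x y, BallEq P P x y n ∧ P' (L.symm x) ≠ P' (L.symm y) := by
    intro n
    by_contra! h
    exact hcon ⟨n, n.cast_nonneg, fun x y hxy => h x y (.of_patchEq hxy)⟩
  choose x y hxy hne using this
  have htr : ∀ z, LIfrom (fun u => P' (u + L.symm z)) P := fun z => hP'.translate _
  have hσtr : ∀ z, σ (fun u => P' (u + L.symm z)) = fun u => P (u + z) := fun z => by
    rw [hσ.map_translate hP' _ (htr z), hσP, LinearEquiv.apply_symm_apply]
  obtain ⟨A, hA⟩ := exists_patternLimit (hyperfilter ℕ) hFLC hε hRD _ fun n => htr (x n)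
  obtain ⟨B, hB⟩ := exists_patternLimit (hyperfilter ℕ) hFLC hε hRD _ fun n => htr (y n)
  have hAP : LIfrom A P := hA.lifrom fun n => htr (x n)
  have hBP : LIfrom B P := hB.lifrom fun n => htr (y n)
  have close : ∀ ρ, ∀ δ > 0, ∃ n s t, ‖L s - L t‖ ≤ δ ∧ A (-s) = P' (L.symm (x n)) ∧
      B (-t) = P' (L.symm (y n)) ∧ BallEq (σ A) P 0 (y n + L s) ρ ∧
      BallEq (σ B) P 0 (y n + L t) (ρ + δ) := by
    intro ρ δ hδ
    obtain ⟨n, ⟨⟨s, hs, hAs, hLs, hσs⟩, ⟨t, ht, hBt, hLt, hσt⟩⟩, hn⟩ :=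
      (((hσ.patternLimit (fun n => htr (x n)) hAP (ρ := ρ) (half_pos hδ) hA).and
        (hσ.patternLimit (fun n => htr (y n)) hBP (ρ := ρ + δ) (half_pos hδ) hB)).and
        (eventually_hyperfilter_ge (δ / 2 + ρ))).exists
    refine ⟨n, s, t, (norm_sub_le _ _).trans (by linarith), ?_, ?_, ?_, ?_⟩
    · simpa using hAs (-s) (by rwa [norm_neg])
    · simpa using hBt (-t) (by rwa [norm_neg])
    · intro u hu
      have h1 := hxy n (L s + u) ((norm_add_le _ _).trans (by linarith))
      rw [hσs u hu, hσtr, add_assoc, ← h1]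
      exact congrArg P (add_comm _ _)
    · intro u hu
      rw [hσt u hu, hσtr]
      exact congrArg P (by abel)
  have hσAB : σ A = σ B := by
    refine hRD.eq_of_small hε (hmaps hBP) fun ρ δ hδ => ?_
    obtain ⟨n, s, t, hst, -, -, h1, h2⟩ := close ρ δ hδ
    refine ⟨L s - L t, hst, fun u hu => ?_⟩
    have h3 := h2 (L s - L t + u) ((norm_add_le _ _).trans (by linarith))
    rw [zero_add] at h3
    rw [h1 u hu, h3]
    exact congrArg P (by abel)
  obtain rfl := hinj hAP hBP hσAB
  obtain ⟨n, s, t, hst, h1, h2, h3, h4⟩ := close V ε hε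
  have h5 : L s - L t = 0 := by
    refine hRD P (LIfrom.refl P) (y n + L t) _ hst ?_
    have : y n + L t + (L s - L t) = y n + L s := by abel
    rw [this]
    exact (h4.mono (by linarith)).symm.trans h3
  obtain rfl := L.injective (sub_eq_zero.1 h5)
  exact hne n (h1.symm.trans h2)

lemma IsIterRule.aperiodic_of_injOn [FiniteDimensional ℝ E] {L : E ≃ₗ[ℝ] E}
    (hL : IsExpansive L) {r : ℝ}
    {P P' : E → S} {σ : (E → S) → (E → S)} (hσ : IsIterRule L r (patternHull P) σ)
    (hFLC : IsFLC P) {ε V : ℝ} (hε : 0 < ε) (hRD : ReturnRadii P ε V)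
    (hP' : LIfrom P' P) (hσP : σ P' = P) (hinj : InjOn σ (patternHull P))
    {Q : E → S} (hQ : LIfrom Q P) {g : E} (hg : ∀ x, Q (x + g) = Q x) : g = 0 := by
  have key : ∀ n : ℕ, ∃ A, LIfrom A P ∧ ∀ x, A (x + (L ^ n).symm g) = A x := by
    intro n
    induction n with
    | zero => exact ⟨Q, hQ, hg⟩
    | succ n ih =>
      obtain ⟨B, hB, hper⟩ := ih
      obtain ⟨A, hAP', hσA⟩ := hσ.exists_preimage hFLC hε hRD (A₀ := P') (B := B)
        (fun C hC => hC.trans hP') hP' (by rw [hσP]; exact hB) hB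
      have hA : LIfrom A P := hAP'.trans hP'
      refine ⟨A, hA, fun x => ?_⟩
      refine congrFun (hinj (hA.translate ((L ^ (n + 1)).symm g)) hA ?_) x
      have hLg : L ((L ^ (n + 1)).symm g) = (L ^ n).symm g := by
        rw [LinearEquiv.eq_symm_apply, ← LinearEquiv.mul_apply, ← pow_succ,
          LinearEquiv.apply_symm_apply]
      rw [hσ.map_translate hA _ (hA.translate _), hσA, hLg]
      exact funext hper
  obtain ⟨C, hC, l, hl, hL⟩ := hL
  have hl0 : 0 < l := by linarith
  obtain ⟨n, hn⟩ := pow_unbounded_of_one_lt (C⁻¹ * ‖g‖ / ε) hl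
  obtain ⟨A, hA, hper⟩ := key n
  have h0 : (L ^ n).symm g = 0 := by
    refine hRD A hA 0 _ ((LinearEquiv.norm_pow_symm_le hC hl hL n g).trans ?_) fun u _ => ?_
    · rw [div_lt_iff₀ hε] at hn
      rw [inv_pow, mul_right_comm, ← div_eq_mul_inv, div_le_iff₀ (by positivity)]
      linarith
    · rw [zero_add, zero_add, add_comm, hper]
  simpa using h0

lemma IsIterRule.injOn_of_aperiodic [FiniteDimensional ℝ E] {L : E ≃ₗ[ℝ] E}
    (hL : IsExpansive L) {r : ℝ}
    {P P' : E → S} {σ : (E → S) → (E → S)} (hσ : IsIterRule L r (patternHull P) σ)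
    (hmaps : MapsTo σ (patternHull P) (patternHull P))
    (hFLC : IsFLC P) {ε V : ℝ} (hε : 0 < ε) (hRD : ReturnRadii P ε V)
    (hP' : LIfrom P' P) (hσP : σ P' = P)
    (hap : ∀ Q, LIfrom Q P → ∀ g : E, (∀ x, Q (x + g) = Q x) → g = 0) :
    InjOn σ (patternHull P) := by
  have hback : ∀ (n : ℕ) (A : E → S), LIfrom A P → ∃ A', LIfrom A' P ∧ σ^[n] A' = A := by
    intro n
    induction n with
    | zero => exact fun A hA => ⟨A, hA, rfl⟩
    | succ n ih =>
      intro A hA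
      obtain ⟨A₁, hA₁, rfl⟩ := ih A hA
      obtain ⟨A₂, hA₂, hσA₂⟩ := hσ.exists_preimage hFLC hε hRD (A₀ := P') (B := A₁)
        (fun C hC => hC.trans hP') hP' (by rw [hσP]; exact hA₁) hA₁
      exact ⟨A₂, hA₂.trans hP', by rw [Function.iterate_succ_apply, hσA₂]⟩
  intro A hA B hB hAB
  by_contra hne
  obtain ⟨x₀, hx₀⟩ := Function.ne_iff.1 hne
  choose f hfP hf using fun n => hback n A hA
  choose g hgP hg using fun n => hback n B hB
  have hfg : ∀ n m, n < m → σ^[m] (f n) = σ^[m] (g n) := by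
    intro n m hnm
    obtain ⟨j, rfl⟩ := Nat.exists_eq_add_of_lt hnm
    rw [show n + j + 1 = j + 1 + n by ring, Function.iterate_add_apply σ (j + 1) n,
      Function.iterate_add_apply σ (j + 1) n, hf, hg, Function.iterate_succ_apply,
      Function.iterate_succ_apply, hAB]
  obtain ⟨A', hA'⟩ := exists_patternLimit (hyperfilter ℕ) hFLC hε hRD f hfP
  obtain ⟨B', hB'⟩ := exists_patternLimit (hyperfilter ℕ) hFLC hε hRD g hgP
  obtain ⟨C, hC, l, hl, hL⟩ := hL
  have hx₀D : ∀ n : ℕ, ‖(L ^ n).symm x₀‖ ≤ C⁻¹ * ‖x₀‖ := fun n => by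
    refine (LinearEquiv.norm_pow_symm_le hC hl hL n x₀).trans ?_
    have : (l⁻¹) ^ n ≤ 1 := pow_le_one₀ (by positivity) (inv_le_one_of_one_le₀ hl.le)
    gcongr
    exact mul_le_of_le_one_right (by positivity) this
  have hD0 : 0 ≤ C⁻¹ * ‖x₀‖ := by positivity
  suffices h : ∃ Q, LIfrom Q P ∧ ∃ g : E, g ≠ 0 ∧ ∀ x, Q (x + g) = Q x by
    obtain ⟨Q, hQ, g, hg0, hper⟩ := h
    exact hg0 (hap Q hQ g hper)
  refine hσ.exists_periodic hmaps hFLC hε hRD fun R => ?_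
  have hR0 : (0 : ℝ) ≤ R := R.cast_nonneg
  set ρ : ℝ := R + C⁻¹ * ‖x₀‖ + 1 with hρ
  have hev := (hA' (ρ + r) (1 / 4) (by norm_num)).and (hB' (ρ + r) (1 / 4) (by norm_num))
  obtain ⟨n, ⟨s, hs, hAs⟩, ⟨t, ht, hBt⟩⟩ := hev.exists
  obtain ⟨m, ⟨⟨s', hs', hAs'⟩, ⟨t', ht', hBt'⟩⟩, hnm⟩ :=
    (hev.and (eventually_hyperfilter_ge (n + 1 : ℕ))).exists
  have hnm : n < m := by exact_mod_cast hnm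
  have hss' : BallEq (f n) (f m) s s' (ρ + r) := hAs.symm.trans hAs'
  have htt' : BallEq (g n) (g m) t t' (ρ + r) := hBt.symm.trans hBt'
  have hitf := fun (i j k : ℕ) (_ : k < i) => iterate_mem_patternHull hmaps (hfP j) k
  have hitg := fun (i j k : ℕ) (_ : k < i) => iterate_mem_patternHull hmaps (hgP j) k
  by_cases hb : (s' - t') - (s - t) = 0
  · exfalso
    apply hx₀
    have h1 := hσ.apply_add (hitf m n) (hitf m m) hss' (z := (L ^ m).symm x₀ - s')
      ((norm_sub_le _ _).trans (by linarith [hx₀D m]))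
    have h2 := hσ.apply_add (hitg m n) (hitg m m) htt' (z := (L ^ m).symm x₀ - t')
      ((norm_sub_le _ _).trans (by linarith [hx₀D m]))
    rw [add_sub_cancel, LinearEquiv.apply_symm_apply] at h1 h2
    have e : s + ((L ^ m).symm x₀ - s') = t + ((L ^ m).symm x₀ - t') := by
      rw [← sub_eq_zero, ← neg_eq_zero, ← hb]
      abel
    rw [← hf m, ← hg m, ← h1, ← h2, hfg n m hnm, e]
  · refine ⟨f n, hfP n, m + 1, s, _, hb, ?_, fun z hz => ?_⟩
    · have h1 := norm_sub_le (s' - t') (s - t)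
      have h2 := norm_sub_le s' t'
      have h3 := norm_sub_le s t
      linarith
    · have h1 := hσ.apply_add (hitf (m + 1) n) (hitf (m + 1) m) hss' (z := z) (by linarith)
      have h2 := hσ.apply_add (hitg (m + 1) n) (hitg (m + 1) m) htt' (z := s' - t' + z) (by
        have h1 := norm_add_le (s' - t') z
        have h2 := norm_sub_le s' t'
        linarith)
      have e1 : t' + (s' - t' + z) = s' + z := by abel
      have e2 : t + (s' - t' + z) = s + (s' - t' - (s - t)) + z := by abel
      rw [e1, e2, ← hfg n (m + 1) (by lia), ← hfg m (m + 1) (by lia)] at h2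
      rw [h1, h2]

/-- Theorem: for an FLC, return discrete pattern `P` that is `L`-sub with predecessor
`P'` and `L` expansive: `P' ≈ P`, and `LP'` and `P` are MLD iff substitution on the hull
is injective iff `P` is aperiodic. -/
theorem stmt3 [FiniteDimensional ℝ E] (L : E ≃ₗ[ℝ] E) (hL : IsExpansive L)
    (P P' : E → S) (hFLC : IsFLC P) (hRD : ReturnDiscrete P) (hsub : IsLSub L P P') :
    LocIso P' P ∧
    ∀ Sub : (E → S) → (E → S),
      IsLDMapOn Sub (distort L '' patternHull P) (patternHull P) →
      Sub (distort L P') = P →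
      ((LD (distort L P') P ∧ LD P (distort L P')) ↔
        Set.InjOn (substMap L Sub) (patternHull P)) ∧
      (Set.InjOn (substMap L Sub) (patternHull P) ↔
        ∀ Q ∈ patternHull P, periods Q = ⊥) := by
  obtain ⟨ε, hε, V, hV⟩ := hRD.exists_returnRadii
  have hPP' : LIfrom P P' := hsub.lifrom hL hFLC hε hV
  refine ⟨⟨hsub.1, hPP'⟩, fun Sub hSub hSubP => ?_⟩
  obtain ⟨c, hc, hloc⟩ := hSub.exists_isLocalRule
  obtain ⟨r, hσ⟩ := hloc.exists_isIterRule hL hc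
  have hmaps : MapsTo (substMap L Sub) (patternHull P) (patternHull P) :=
    fun A hA => hSub.1 (mem_image_of_mem _ hA)
  have hσP : substMap L Sub P' = P := hSubP
  refine ⟨⟨fun h => hσ.injOn_of_ld hsub.1 hPP' hσP h.2, fun h =>
    ⟨hsub.2, hσ.ld_of_injOn hmaps hFLC hε hV hsub.1 hσP h⟩⟩, fun h Q hQ => ?_, fun h => ?_⟩
  · exact (AddSubgroup.eq_bot_iff_forall _).2 fun g hg =>
      hσ.aperiodic_of_injOn hL hFLC hε hV hsub.1 hσP h hQ hg
  · exact hσ.injOn_of_aperiodic hL hmaps hFLC hε hV hsub.1 hσP fun Q hQ g hg =>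
      (AddSubgroup.eq_bot_iff_forall _).1 (h Q hQ) g hg
end
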